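/- arXiv:2301.01591 — 2 statements merged into one kernel-verified Lean document; each statement's English description precedes it below -/
import Mathlib

section
/- Let α ∈ (0,1) and set r = √(1−α²). For each n ≥ 2 let P_n* be a monic real polynomial of degree ⌊α·n⌋ that minimizes ‖P‖_{E_n} among all monic real polynomials of degree ⌊α·n⌋, and let ν_n = (1/n) Σ_{x : P_n*(x)=0} δ_x be its normalized zero counting measure. Then ν_n converges weak* to μ_α as n → ∞ (∫ f dν_n → ∫ f dμ_α for every bounded continuous f : ℝ → ℝ), and lim_{n→∞} (1/n) · log ‖P_n*‖_{E_n} = − min_{x ∈ [−r,r]} U^{μ_α}(x). -/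
open MeasureTheory Polynomial Filter Set

/-- The `n`-grid: `n` equally spaced points in `[-1,1]` including the endpoints. -/
noncomputable def nGrid (n : ℕ) : Set ℝ :=
  {x | ∃ k : ℕ, 1 ≤ k ∧ k ≤ n ∧ x = (2 * (k : ℝ) - n - 1) / ((n : ℝ) - 1)}

/-- Uniform norm of a real polynomial on the interval `[-1,1]`. -/
noncomputable def normI (p : Polynomial ℝ) : ℝ :=
  sSup ((fun x => |p.eval x|) '' Set.Icc (-1 : ℝ) 1)

/-- Uniform norm of a real polynomial on the `n`-grid. -/
noncomputable def normE (n : ℕ) (p : Polynomial ℝ) : ℝ :=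
  sSup ((fun x => |p.eval x|) '' nGrid n)

/-- The constant `C(α)`. -/
noncomputable def Cconst (α : ℝ) : ℝ :=
  ((1 + α) * Real.log (1 + α) + (1 - α) * Real.log (1 - α)) / 2

/-- The constraining measure `σ`: density `1/2` w.r.t. Lebesgue measure on `[-1,1]`. -/
noncomputable def sigmaM : Measure ℝ :=
  (2 : ENNReal)⁻¹ • (volume.restrict (Set.Icc (-1 : ℝ) 1))

/-- Logarithmic potential of a measure on `ℝ`. -/
noncomputable def logPot (μ : Measure ℝ) (x : ℝ) : ℝ :=
  ∫ y, Real.log (1 / |x - y|) ∂μ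

/-- Topological support of a measure on `ℝ`. -/
def msupport (μ : Measure ℝ) : Set ℝ :=
  {x | ∀ U : Set ℝ, IsOpen U → x ∈ U → μ U ≠ 0}

/-- Normalized zero counting measure (zeros counted with multiplicity,
normalized by `1/n`). -/
noncomputable def zeroMeasure (n : ℕ) (p : Polynomial ℝ) : Measure ℝ :=
  ((n : ENNReal))⁻¹ • (p.roots.map (fun x => MeasureTheory.Measure.dirac x)).sum

/-- Density of the constrained equilibrium measure `μ_α` (with `r = √(1-α²)`). -/
noncomputable def mualphaDensity (α x : ℝ) : ℝ :=
  if |x| < Real.sqrt (1 - α ^ 2) then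
    (1 / Real.pi) * Real.arctan (α / Real.sqrt ((1 - α ^ 2) - x ^ 2))
  else (1 : ℝ) / 2

/-- The constrained equilibrium measure `μ_α` on `[-1,1]`. -/
noncomputable def mualpha (α : ℝ) : Measure ℝ :=
  (volume.restrict (Set.Icc (-1 : ℝ) 1)).withDensity
    (fun x => ENNReal.ofReal (mualphaDensity α x))

/-- The monic polynomials defined by the three-term recurrence
`T (k+2) = X * T (k+1) - c (k+1) * T k`. -/
noncomputable def recPoly (c : ℕ → ℝ) : ℕ → ℝ[X]
  | 0 => 1
  | 1 => X
  | k + 2 => X * recPoly c (k + 1) - C (c (k + 1)) * recPoly c k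

/-- The recurrence coefficients of the discrete Chebyshev (Gram) polynomials on the `n`-grid. -/
noncomputable def gramCoeff (n k : ℕ) : ℝ :=
  (k : ℝ) ^ 2 * ((n : ℝ) ^ 2 - (k : ℝ) ^ 2) / ((4 * (k : ℝ) ^ 2 - 1) * ((n : ℝ) - 1) ^ 2)

/-- The points of the `n`-grid, indexed from `0`. -/
noncomputable def gridPt (n j : ℕ) : ℝ := -1 + j * (2 / ((n : ℝ) - 1))

theorem recPoly_monic_natDegree (c : ℕ → ℝ) (k : ℕ) :
    (recPoly c k).Monic ∧ (recPoly c k).natDegree = k ∧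
      (recPoly c (k + 1)).Monic ∧ (recPoly c (k + 1)).natDegree = k + 1 := by
  induction k with
  | zero => simp [recPoly, monic_X]
  | succ k ih =>
    obtain ⟨h1, h2, h3, h4⟩ := ih
    refine ⟨h3, h4, ?_⟩
    have hm : (X * recPoly c (k + 1)).Monic := monic_X.mul h3
    have hd : (X * recPoly c (k + 1)).natDegree = k + 2 := by
      rw [natDegree_X_mul h3.ne_zero, h4]
    have hlt : (C (c (k + 1)) * recPoly c k).degree < (X * recPoly c (k + 1)).degree := by
      rw [degree_eq_natDegree hm.ne_zero, hd]
      refine lt_of_le_of_lt (degree_le_natDegree.trans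
        (Nat.cast_le.mpr ((natDegree_C_mul_le _ _).trans h2.le))) ?_
      exact_mod_cast (by omega : k < k + 2)
    refine ⟨?_, ?_⟩
    · rw [recPoly]; exact hm.sub_of_left hlt
    · rw [recPoly, natDegree_sub_eq_left_of_natDegree_lt, hd]
      exact lt_of_le_of_lt ((natDegree_C_mul_le _ _).trans h2.le) (by rw [hd]; omega)

theorem recPoly_monic (c : ℕ → ℝ) (k : ℕ) : (recPoly c k).Monic :=
  (recPoly_monic_natDegree c k).1

theorem natDegree_recPoly (c : ℕ → ℝ) (k : ℕ) : (recPoly c k).natDegree = k :=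
  (recPoly_monic_natDegree c k).2.1

theorem gramCoeff_succ_relation (n k : ℕ) (hn : 2 ≤ n) :
    gramCoeff n (k + 1) * (4 * k + 6) - gramCoeff n k * (4 * k - 2) =
      (2 / ((n : ℝ) - 1)) ^ 2 * ((n : ℝ) ^ 2 / 2 - (k : ℝ) ^ 2 - k - 1 / 2) := by
  have h2 : (2 : ℝ) ≤ n := by exact_mod_cast hn
  have h1 : (n : ℝ) - 1 ≠ 0 := by linarith
  have ha : (4 * ((k : ℝ) + 1) ^ 2 - 1) = (2 * k + 1) * (2 * k + 3) := by ring
  have hb : (4 * (k : ℝ) ^ 2 - 1) = (2 * k - 1) * (2 * k + 1) := by ring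
  have hk : (0 : ℝ) ≤ k := Nat.cast_nonneg k
  have hk1 : (2 * (k : ℝ) + 1) ≠ 0 := by positivity
  have hk3 : (2 * (k : ℝ) + 3) ≠ 0 := by positivity
  have hk2 : (2 * (k : ℝ) - 1) ≠ 0 := by
    intro h
    have : (2 * (k : ℤ) - 1) = 0 := by exact_mod_cast h
    omega
  have e1 : gramCoeff n k * (4 * k - 2) =
      2 * (k : ℝ) ^ 2 * ((n : ℝ) ^ 2 - (k : ℝ) ^ 2) / ((2 * k + 1) * ((n : ℝ) - 1) ^ 2) := by
    unfold gramCoeff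
    rw [hb, div_mul_eq_mul_div, div_eq_div_iff (by positivity) (by positivity)]
    ring
  have e2 : gramCoeff n (k + 1) * (4 * k + 6) = 2 * ((k : ℝ) + 1) ^ 2 *
      ((n : ℝ) ^ 2 - ((k : ℝ) + 1) ^ 2) / ((2 * k + 1) * ((n : ℝ) - 1) ^ 2) := by
    unfold gramCoeff
    push_cast
    rw [ha, div_mul_eq_mul_div, div_eq_div_iff (by positivity) (by positivity)]
    ring
  rw [e1, e2]
  field_simp
  ring

/-- The second-order difference equation satisfied by the Gram polynomials, proved together with
a first-order structure relation. -/
theorem gram_difference_equation (n : ℕ) (hn : 2 ≤ n) (d : ℝ) (hd : d = 2 / ((n : ℝ) - 1))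
    (t : ℕ → ℝ → ℝ) (ht : ∀ k x, t k x = (recPoly (gramCoeff n) k).eval x)
    (a : ℝ → ℝ) (ha : ∀ x, a x = (x + d / 2) ^ 2 - (n * d / 2) ^ 2) (k : ℕ) :
    (∀ x, a x * (t k (x + d) - t k x) - a (x - d) * (t k x - t k (x - d))
        = d ^ 2 * (k * (k + 1)) * t k x) ∧
    (∀ x, a x * t k (x + d) - a (x - d) * t k (x - d)
        = 2 * d * (k + 1) * (x * t k x) - d * (4 * k + 2) * (x * t k x - t (k + 1) x)) ∧
    (∀ x, a x * (t (k + 1) (x + d) - t (k + 1) x) - a (x - d) * (t (k + 1) x - t (k + 1) (x - d))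
        = d ^ 2 * ((k + 1) * (k + 2)) * t (k + 1) x) ∧
    (∀ x, a x * t (k + 1) (x + d) - a (x - d) * t (k + 1) (x - d)
        = 2 * d * (k + 2) * (x * t (k + 1) x)
          - d * (4 * k + 6) * (gramCoeff n (k + 1) * t k x)) := by
  have hrec : ∀ k x, t (k + 2) x = x * t (k + 1) x - gramCoeff n (k + 1) * t k x := by
    intro k x; simp [ht, recPoly]
  have h0 : ∀ x, t 0 x = 1 := by intro x; simp [ht, recPoly]
  have h1 : ∀ x, t 1 x = x := by intro x; simp [ht, recPoly]
  have hc := fun k => gramCoeff_succ_relation n k hn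
  rw [← hd] at hc
  induction k with
  | zero =>
    have hc0 := hc 0
    have hg0 : gramCoeff n 0 = 0 := by simp [gramCoeff]
    rw [hg0] at hc0
    push_cast at hc0
    refine ⟨fun x => ?_, fun x => ?_, fun x => ?_, fun x => ?_⟩
    · simp [h0]
    · simp only [h0, h1, ha, zero_add]; push_cast; ring
    · simp only [h1, ha, zero_add]; push_cast; ring
    · simp only [h0, h1, ha, zero_add]; push_cast
      linear_combination d * hc0
  | succ k ih =>
    obtain ⟨i1, i2, i3, i4⟩ := ih
    refine ⟨fun x => ?_, fun x => ?_, fun x => ?_, fun x => ?_⟩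
    · have := i3 x; push_cast; linear_combination this
    · rw [show k + 1 + 1 = k + 2 from rfl]; push_cast
      linear_combination i4 x - d * (4 * k + 6) * hrec k x
    · have e1 := i1 x; have e3 := i3 x; have e4 := i4 x
      rw [show k + 1 + 1 = k + 2 from rfl, hrec, hrec, hrec]; push_cast
      linear_combination x * e3 + d * e4 - gramCoeff n (k + 1) * e1
    · have e1 := i1 x; have e2 := i2 x; have e3 := i3 x; have e4 := i4 x
      have hck := hc (k + 1)
      rw [show k + 1 + 1 = k + 2 from rfl] at *
      rw [hrec, hrec, hrec]; push_cast at hck ⊢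
      have hs : a x + a (x - d) = 2 * x ^ 2 + d ^ 2 / 2 - n ^ 2 * d ^ 2 / 2 := by
        rw [ha, ha]; ring
      linear_combination x * e4 + d * e3 + d * t (k + 1) x * hs - gramCoeff n (k + 1) * e2
        + d * t (k + 1) x * hck

theorem sum_gram_mul_gram (n : ℕ) (hn : 2 ≤ n) {i k : ℕ} (hik : i ≠ k) :
    ∑ j ∈ Finset.range n, (recPoly (gramCoeff n) i).eval (gridPt n j) *
      (recPoly (gramCoeff n) k).eval (gridPt n j) = 0 := by
  set d : ℝ := 2 / ((n : ℝ) - 1) with hd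
  have h2 : (2 : ℝ) ≤ n := by exact_mod_cast hn
  have h1 : (n : ℝ) - 1 ≠ 0 := by linarith
  have hdpos : 0 < d := by rw [hd]; apply div_pos <;> linarith
  have hnd : (n : ℝ) * d = 2 + d := by rw [hd]; field_simp; ring
  set t : ℕ → ℝ → ℝ := fun k x => (recPoly (gramCoeff n) k).eval x with ht
  set a : ℝ → ℝ := fun x => (x + d / 2) ^ 2 - (n * d / 2) ^ 2 with ha
  have hD := fun k => (gram_difference_equation n hn d hd t (fun _ _ => rfl) a (fun _ => rfl) k).1
  set W : ℝ → ℝ := fun x => a x * (t i (x + d) * t k x - t i x * t k (x + d)) with hW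
  have key : ∀ x, d ^ 2 * ((i : ℝ) * (i + 1) - k * (k + 1)) * (t i x * t k x)
      = W x - W (x - d) := by
    intro x
    have e1 := hD i x
    have e2 := hD k x
    simp only [hW, sub_add_cancel]
    linear_combination (-t k x) * e1 + t i x * e2
  have hsum : ∑ j ∈ Finset.range n, d ^ 2 * ((i : ℝ) * (i + 1) - k * (k + 1)) *
      (t i (gridPt n j) * t k (gridPt n j)) = 0 := by
    have : ∀ j ∈ Finset.range n, d ^ 2 * ((i : ℝ) * (i + 1) - k * (k + 1)) *
      (t i (gridPt n j) * t k (gridPt n j)) =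
        W (-1 + ((j + 1 : ℕ) : ℝ) * d - d) - W (-1 + (j : ℝ) * d - d) := by
      intro j _
      rw [key]
      simp only [gridPt, ← hd]
      congr 2
      push_cast; ring
    rw [Finset.sum_congr rfl this, Finset.sum_range_sub (fun j : ℕ => W (-1 + (j : ℝ) * d - d))]
    have w1 : a (-1 + (n : ℝ) * d - d) = 0 := by simp only [ha]; rw [hnd]; ring
    have w2 : a (-1 + ((0 : ℕ) : ℝ) * d - d) = 0 := by simp only [ha]; rw [hnd]; push_cast; ring
    simp only [hW, w1, w2]; ring
  rw [← Finset.mul_sum] at hsum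
  have hne : d ^ 2 * ((i : ℝ) * (i + 1) - k * (k + 1)) ≠ 0 := by
    have h3 : (i : ℝ) * (i + 1) - k * (k + 1) = ((i : ℝ) - k) * (i + k + 1) := by ring
    rw [h3]
    refine mul_ne_zero (by positivity) (mul_ne_zero ?_ (by positivity))
    rw [sub_ne_zero]; exact_mod_cast hik
  exact (mul_eq_zero.mp hsum).resolve_left hne

theorem sum_gram_sq (n : ℕ) (hn : 2 ≤ n) (m : ℕ) :
    ∑ j ∈ Finset.range n, (recPoly (gramCoeff n) m).eval (gridPt n j) ^ 2 =
      n * ∏ k ∈ Finset.range m, gramCoeff n (k + 1) := by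
  induction m with
  | zero => simp [recPoly]
  | succ m ih =>
    rw [Finset.prod_range_succ, ← mul_assoc, ← ih, Finset.sum_mul]
    set t : ℕ → ℝ → ℝ := fun k x => (recPoly (gramCoeff n) k).eval x with ht
    have hrec : ∀ k x, t (k + 2) x = x * t (k + 1) x - gramCoeff n (k + 1) * t k x := by
      intro k x; simp [ht, recPoly]
    have ho := sum_gram_mul_gram n hn (show m + 2 ≠ m by omega)
    have hx : ∑ j ∈ Finset.range n, t (m + 1) (gridPt n j) *
        (gridPt n j * t m (gridPt n j) - t (m + 1) (gridPt n j)) = 0 := by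
      rcases m with _ | m
      · simp [ht, recPoly]
      · have := sum_gram_mul_gram n hn (show m + 2 ≠ m by omega)
        have e : ∀ x, t (m + 2) x * (x * t (m + 1) x - t (m + 2) x) =
            gramCoeff n (m + 1) * (t (m + 2) x * t m x) := by
          intro x; rw [hrec]; ring
        rw [Finset.sum_congr rfl (fun j _ => e (gridPt n j)), ← Finset.mul_sum]
        simp only [ht]
        rw [this, mul_zero]
    change ∑ j ∈ Finset.range n, t (m + 1) (gridPt n j) ^ 2 =
      ∑ j ∈ Finset.range n, t m (gridPt n j) ^ 2 * gramCoeff n (m + 1)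
    change ∑ j ∈ Finset.range n, t (m + 2) (gridPt n j) * t m (gridPt n j) = 0 at ho
    rw [← sub_eq_zero, ← Finset.sum_sub_distrib]
    have : ∑ j ∈ Finset.range n, (t (m + 1) (gridPt n j) ^ 2 -
        t m (gridPt n j) ^ 2 * gramCoeff n (m + 1)) =
        ∑ j ∈ Finset.range n, t (m + 2) (gridPt n j) * t m (gridPt n j) -
        ∑ j ∈ Finset.range n, t (m + 1) (gridPt n j) *
        (gridPt n j * t m (gridPt n j) - t (m + 1) (gridPt n j)) := by
      rw [← Finset.sum_sub_distrib]
      refine Finset.sum_congr rfl fun j _ => ?_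
      rw [hrec]; ring
    rw [this, ho, hx, sub_zero]

theorem nGrid_eq_image (n : ℕ) (hn : 2 ≤ n) :
    nGrid n = (gridPt n) '' (Finset.range n : Set ℕ) := by
  have h2 : (2 : ℝ) ≤ n := by exact_mod_cast hn
  have h1 : (n : ℝ) - 1 ≠ 0 := by linarith
  ext x
  simp only [nGrid, mem_ofPred_eq, mem_image, Finset.coe_range, mem_Iio, gridPt]
  constructor
  · rintro ⟨k, hk1, hkn, rfl⟩
    refine ⟨k - 1, by omega, ?_⟩
    rw [Nat.cast_sub hk1]
    field_simp
    push_cast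
    ring
  · rintro ⟨j, hj, rfl⟩
    refine ⟨j + 1, by omega, by omega, ?_⟩
    field_simp
    push_cast
    ring

theorem gridPt_mem_Icc {n : ℕ} (hn : 2 ≤ n) {j : ℕ} (hj : j < n) :
    gridPt n j ∈ Icc (-1 : ℝ) 1 := by
  have h2 : (2 : ℝ) ≤ n := by exact_mod_cast hn
  have h1 : (0 : ℝ) < (n : ℝ) - 1 := by linarith
  have hj' : (j : ℝ) ≤ n - 1 := by
    have : (j : ℝ) + 1 ≤ n := by exact_mod_cast hj
    linarith
  have hj0 : (0 : ℝ) ≤ j := Nat.cast_nonneg j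
  unfold gridPt
  constructor
  · have : 0 ≤ (j : ℝ) * (2 / ((n : ℝ) - 1)) := by positivity
    linarith
  · have : (j : ℝ) * (2 / ((n : ℝ) - 1)) ≤ 2 := by
      rw [mul_div_assoc', div_le_iff₀ h1]; nlinarith
    linarith

theorem gridPt_injective {n : ℕ} (hn : 2 ≤ n) : Function.Injective (gridPt n) := by
  have h2 : (2 : ℝ) ≤ n := by exact_mod_cast hn
  have h1 : (0 : ℝ) < 2 / ((n : ℝ) - 1) := by apply div_pos <;> linarith
  intro i j h
  unfold gridPt at h
  have := mul_right_cancel₀ h1.ne' (add_left_cancel h)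
  exact_mod_cast this

theorem abs_eval_le_normE {n : ℕ} (hn : 2 ≤ n) (p : ℝ[X]) {j : ℕ} (hj : j < n) :
    |p.eval (gridPt n j)| ≤ normE n p := by
  unfold normE
  rw [nGrid_eq_image n hn]
  refine le_csSup ?_ ?_
  · exact ((Finset.finite_toSet _).image _ |>.image _).bddAbove
  · exact mem_image_of_mem _ (mem_image_of_mem _ (by simpa using hj))

theorem exists_abs_eval_eq_normE {n : ℕ} (hn : 2 ≤ n) (p : ℝ[X]) :
    ∃ j < n, |p.eval (gridPt n j)| = normE n p := by
  have hfin : ((fun x => |p.eval x|) '' nGrid n).Finite := by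
    rw [nGrid_eq_image n hn]
    exact ((Finset.finite_toSet _).image _).image _
  have hne : ((fun x => |p.eval x|) '' nGrid n).Nonempty := by
    rw [nGrid_eq_image n hn]
    exact ⟨_, mem_image_of_mem _ (mem_image_of_mem _ (show 0 ∈ _ by simp; omega))⟩
  have := hne.csSup_mem hfin
  rw [nGrid_eq_image n hn] at this
  obtain ⟨_, ⟨j, hj, rfl⟩, h⟩ := this
  refine ⟨j, by simpa using hj, ?_⟩
  rw [normE, nGrid_eq_image n hn]
  exact h

theorem normE_pos {n : ℕ} (hn : 2 ≤ n) {p : ℝ[X]} (hp : p ≠ 0) (hd : p.natDegree < n) :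
    0 < normE n p := by
  by_contra hcon
  have hz : ∀ j < n, p.eval (gridPt n j) = 0 := fun j hj =>
    abs_nonpos_iff.mp ((abs_eval_le_normE hn p hj).trans (not_lt.mp hcon))
  apply hp
  refine eq_zero_of_natDegree_lt_card_of_eval_eq_zero' p ((Finset.range n).image (gridPt n)) ?_ ?_
  · intro x hx
    obtain ⟨j, hj, rfl⟩ := Finset.mem_image.mp hx
    exact hz j (by simpa using hj)
  · rw [Finset.card_image_of_injective _ (gridPt_injective hn)]
    simpa using hd

theorem normE_lt_normE {n : ℕ} (hn : 2 ≤ n) {p q : ℝ[X]} (hp : p ≠ 0) (hd : p.natDegree < n)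
    (h : ∀ x ∈ Icc (-1 : ℝ) 1, (p.eval x = 0 → q.eval x = 0) ∧
      (p.eval x ≠ 0 → |q.eval x| < |p.eval x|)) :
    normE n q < normE n p := by
  obtain ⟨j, hj, hq⟩ := exists_abs_eval_eq_normE hn q
  obtain ⟨h1, h2⟩ := h _ (gridPt_mem_Icc hn hj)
  rw [← hq]
  by_cases h0 : p.eval (gridPt n j) = 0
  · rw [h1 h0, abs_zero]; exact normE_pos hn hp hd
  · exact (h2 h0).trans_le (abs_eval_le_normE hn p hj)

/-- Replacing a monic factor by a smaller one of the same degree contradicts minimality. -/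
theorem not_minimal_of_factor {n : ℕ} (hn : 2 ≤ n) {p f g u : ℝ[X]} (hp : p.Monic)
    (hd : p.natDegree < n)
    (hmin : ∀ Q : ℝ[X], Q.Monic → Q.natDegree = p.natDegree → normE n p ≤ normE n Q)
    (hpu : p = f * u) (hf : f.Monic) (hg : g.Monic) (hfg : g.natDegree = f.natDegree)
    (h : ∀ x ∈ Icc (-1 : ℝ) 1, |g.eval x| < |f.eval x|) : False := by
  have hu : u.Monic := hf.of_mul_monic_left (hpu ▸ hp)
  have h1 := hmin (g * u) (hg.mul hu) (by rw [hpu, hg.natDegree_mul hu, hf.natDegree_mul hu, hfg])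
  refine absurd h1 (not_le.mpr (normE_lt_normE hn hp.ne_zero hd fun x hx => ?_))
  have hx' := h x hx
  have hfx : f.eval x ≠ 0 := by
    intro h0; rw [h0, abs_zero] at hx'; exact absurd hx' (not_lt.mpr (abs_nonneg _))
  subst hpu
  simp only [eval_mul, abs_mul, mul_eq_zero, hfx, false_or, ne_eq]
  refine ⟨fun hu0 => Or.inr hu0, fun hu0 => ?_⟩
  exact mul_lt_mul_of_pos_right hx' (abs_pos.mpr hu0)

theorem minimal_roots_mem_Icc {n : ℕ} (hn : 2 ≤ n) {p : ℝ[X]} (hp : p.Monic)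
    (hd : p.natDegree < n)
    (hmin : ∀ Q : ℝ[X], Q.Monic → Q.natDegree = p.natDegree → normE n p ≤ normE n Q) :
    ∀ x ∈ p.roots, x ∈ Icc (-1 : ℝ) 1 := by
  intro a ha
  have hroot : p.IsRoot a := (mem_roots hp.ne_zero).mp ha
  have hmul : p = (X - C a) * (p /ₘ (X - C a)) := (mul_divByMonic_eq_iff_isRoot.mpr hroot).symm
  constructor
  · by_contra hcon
    refine not_minimal_of_factor hn hp hd hmin hmul (monic_X_sub_C a) (monic_X_sub_C (-1))
      (by simp only [natDegree_X_sub_C]) fun x hx => ?_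
    simp only [eval_sub, eval_X, eval_C]
    rw [abs_of_nonneg (by linarith [hx.1]), abs_of_nonneg (by linarith [hx.1])]
    linarith
  · by_contra hcon
    refine not_minimal_of_factor hn hp hd hmin hmul (monic_X_sub_C a) (monic_X_sub_C 1)
      (by simp only [natDegree_X_sub_C]) fun x hx => ?_
    simp only [eval_sub, eval_X, eval_C]
    rw [abs_of_nonpos (by linarith [hx.2]), abs_of_nonpos (by linarith [hx.2])]
    linarith

theorem minimal_eq_prod_roots {n : ℕ} (hn : 2 ≤ n) {p : ℝ[X]} (hp : p.Monic)
    (hd : p.natDegree < n)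
    (hmin : ∀ Q : ℝ[X], Q.Monic → Q.natDegree = p.natDegree → normE n p ≤ normE n Q) :
    (p.roots.map fun a => X - C a).prod = p ∧ p.roots.card = p.natDegree := by
  obtain ⟨q, hq, hdeg, hroots⟩ := exists_prod_multiset_X_sub_C_mul p
  have hqm : q.Monic := by
    refine (monic_multiset_prod_of_monic p.roots (fun a : ℝ => X - C a)
      fun a _ => monic_X_sub_C a).of_mul_monic_left ?_
    rw [hq]; exact hp
  have hq0 : q.natDegree = 0 := by
    by_contra hne
    have hdq : 0 < q.degree := natDegree_pos_iff_degree_pos.mp (Nat.pos_of_ne_zero hne)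
    have hdm : (q.map (algebraMap ℝ ℂ)).degree ≠ 0 := by
      rw [degree_map]; exact hdq.ne'
    obtain ⟨z, hz⟩ := IsAlgClosed.exists_root _ hdm
    have hz' : aeval z q = 0 := by rwa [IsRoot, eval_map_algebraMap] at hz
    by_cases him : z.im = 0
    · have hzr : z = algebraMap ℝ ℂ z.re := Complex.ext rfl (by simpa using him)
      rw [hzr, aeval_algebraMap_apply] at hz'
      have h0 : q.eval z.re = 0 := by
        have h1 : (algebraMap ℝ ℂ) (q.eval z.re) = 0 := by simpa [aeval_def] using hz'
        exact (map_eq_zero _).mp h1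
      have : z.re ∈ q.roots := (mem_roots hqm.ne_zero).mpr h0
      rw [hroots] at this
      exact absurd this (Multiset.notMem_zero _)
    · have hpz : aeval z p = 0 := by rw [← hq, map_mul, hz', mul_zero]
      obtain ⟨u, hu⟩ := quadratic_dvd_of_aeval_eq_zero_im_ne_zero p hpz him
      have hfm : (X ^ 2 - C (2 * z.re) * X + C (‖z‖ ^ 2)).Monic := by monicity!
      have hfd : (X ^ 2 - C (2 * z.re) * X + C (‖z‖ ^ 2)).natDegree = 2 := by compute_degree!
      refine not_minimal_of_factor hn hp hd hmin hu hfm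
        ((monic_X_sub_C z.re).pow 2) ?_ fun x _ => ?_
      · rw [hfd, (monic_X_sub_C z.re).natDegree_pow, natDegree_X_sub_C]
      · have hn2 : ‖z‖ ^ 2 = z.re ^ 2 + z.im ^ 2 := by
          rw [Complex.sq_norm, Complex.normSq_apply]; ring
        have e : (X ^ 2 - C (2 * z.re) * X + C (‖z‖ ^ 2)).eval x = (x - z.re) ^ 2 + z.im ^ 2 := by
          simp [hn2]; ring
        rw [e]
        simp only [eval_pow, eval_sub, eval_X, eval_C]
        rw [abs_of_nonneg (by positivity), abs_of_nonneg (by positivity)]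
        have : 0 < z.im ^ 2 := by positivity
        linarith
  have hq1 : q = 1 := eq_one_of_monic_natDegree_zero hqm hq0
  rw [hq1, mul_one] at hq
  exact ⟨hq, by rw [hq0] at hdeg; simpa using hdeg⟩

theorem gramCoeff_pos {n k : ℕ} (hk : 1 ≤ k) (hkn : k < n) : 0 < gramCoeff n k := by
  have h1 : (1 : ℝ) ≤ k := by exact_mod_cast hk
  have h2 : (k : ℝ) + 1 ≤ n := by exact_mod_cast hkn
  unfold gramCoeff
  apply div_pos
  · apply mul_pos (by positivity); nlinarith
  · apply mul_pos
    · nlinarith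
    · have : (0 : ℝ) < n - 1 := by linarith
      positivity

theorem gramCoeff_le_one {n k : ℕ} (hk : 1 ≤ k) (hkn : k < n) : gramCoeff n k ≤ 1 := by
  have h1 : (1 : ℝ) ≤ k := by exact_mod_cast hk
  have h2 : (k : ℝ) + 1 ≤ n := by exact_mod_cast hkn
  have h3 : (0 : ℝ) < n - 1 := by linarith
  unfold gramCoeff
  rw [div_le_one (mul_pos (by nlinarith) (by positivity))]
  have h4 : (k : ℝ) ^ 2 ≤ (4 * (k : ℝ) ^ 2 - 1) / 3 := by nlinarith
  have h5 : (n : ℝ) ^ 2 - (k : ℝ) ^ 2 ≤ 3 * ((n : ℝ) - 1) ^ 2 := by nlinarith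
  have h6 : 0 ≤ (n : ℝ) ^ 2 - (k : ℝ) ^ 2 := by nlinarith
  calc (k : ℝ) ^ 2 * ((n : ℝ) ^ 2 - (k : ℝ) ^ 2)
      ≤ (4 * (k : ℝ) ^ 2 - 1) / 3 * (3 * ((n : ℝ) - 1) ^ 2) := by gcongr; nlinarith
    _ = _ := by ring

theorem exists_recPoly_expansion (c : ℕ → ℝ) (m : ℕ) (p : ℝ[X]) (hp : p.degree < m) :
    ∃ a : ℕ → ℝ, p = ∑ j ∈ Finset.range m, C (a j) * recPoly c j := by
  induction m generalizing p with
  | zero =>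
    refine ⟨0, ?_⟩
    have : p = 0 := by rw [← degree_eq_bot]; simpa using hp
    simp [this]
  | succ m ih =>
    have hT := recPoly_monic c m
    have hTd := natDegree_recPoly c m
    have hlt : (p - C (p.coeff m) * recPoly c m).degree < m := by
      rw [degree_lt_iff_coeff_zero]
      intro k hk
      rcases hk.eq_or_lt with rfl | hk
      · have : (recPoly c m).coeff m = 1 := by
          have := hT.coeff_natDegree; rwa [hTd] at this
        simp [this]
      · rw [coeff_sub, coeff_C_mul, coeff_eq_zero_of_natDegree_lt (hTd.trans_lt hk),
          coeff_eq_zero_of_degree_lt (hp.trans_le (by exact_mod_cast hk))]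
        simp
    obtain ⟨a, ha⟩ := ih _ hlt
    refine ⟨fun j => if j = m then p.coeff m else a j, ?_⟩
    rw [Finset.sum_range_succ]
    beta_reduce
    rw [if_pos rfl, ← sub_eq_iff_eq_add, ha]
    refine Finset.sum_congr rfl fun j hj => ?_
    rw [if_neg (Finset.mem_range.mp hj).ne]

theorem exists_recPoly_expansion_monic (c : ℕ → ℝ) {p : ℝ[X]} (hp : p.Monic) :
    ∃ a : ℕ → ℝ, a p.natDegree = 1 ∧
      p = ∑ j ∈ Finset.range (p.natDegree + 1), C (a j) * recPoly c j := by
  have hT := recPoly_monic c p.natDegree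
  have hTd := natDegree_recPoly c p.natDegree
  have hlt : (p - recPoly c p.natDegree).degree < p.natDegree := by
    rw [← degree_eq_natDegree hp.ne_zero]
    refine degree_sub_lt_left ?_ hp.ne_zero (by rw [hp.leadingCoeff, hT.leadingCoeff])
    rw [degree_eq_natDegree hp.ne_zero, degree_eq_natDegree hT.ne_zero, hTd]
  obtain ⟨a, ha⟩ := exists_recPoly_expansion c _ _ hlt
  refine ⟨fun j => if j = p.natDegree then 1 else a j, if_pos rfl, ?_⟩
  rw [Finset.sum_range_succ]
  beta_reduce
  rw [if_pos rfl, C_1, one_mul, ← sub_eq_iff_eq_add]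
  conv_lhs => rw [ha]
  refine Finset.sum_congr rfl fun j hj => ?_
  rw [if_neg (Finset.mem_range.mp hj).ne]

theorem sum_sq_eval_expansion {n : ℕ} (hn : 2 ≤ n) (M : ℕ) (a : ℕ → ℝ) :
    ∑ i ∈ Finset.range n, (∑ j ∈ Finset.range M,
      C (a j) * recPoly (gramCoeff n) j).eval (gridPt n i) ^ 2 =
    ∑ j ∈ Finset.range M, a j ^ 2 * (n * ∏ k ∈ Finset.range j, gramCoeff n (k + 1)) := by
  simp only [eval_finsetSum, eval_mul, eval_C, sq (Finset.sum _ _), Finset.sum_mul_sum]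
  rw [Finset.sum_comm]
  refine Finset.sum_congr rfl fun j hj => ?_
  rw [Finset.sum_comm, Finset.sum_eq_single j]
  · rw [← sum_gram_sq n hn j, Finset.mul_sum]
    exact Finset.sum_congr rfl fun i _ => by ring
  · intro k _ hk
    have := sum_gram_mul_gram n hn hk.symm
    rw [← mul_zero (a j * a k), ← this, Finset.mul_sum]
    exact Finset.sum_congr rfl fun i _ => by ring
  · intro h; exact absurd hj h

theorem sum_sq_le_normE {n : ℕ} (hn : 2 ≤ n) (p : ℝ[X]) :
    ∑ i ∈ Finset.range n, p.eval (gridPt n i) ^ 2 ≤ n * normE n p ^ 2 := by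
  have : ∀ i ∈ Finset.range n, p.eval (gridPt n i) ^ 2 ≤ normE n p ^ 2 := fun i hi => by
    rw [← sq_abs]
    gcongr
    exact abs_eval_le_normE hn p (Finset.mem_range.mp hi)
  simpa using Finset.sum_le_sum this

theorem normE_gram_sq_le {n : ℕ} (hn : 2 ≤ n) (m : ℕ) :
    normE n (recPoly (gramCoeff n) m) ^ 2 ≤ n * ∏ k ∈ Finset.range m, gramCoeff n (k + 1) := by
  obtain ⟨j, hj, h⟩ := exists_abs_eval_eq_normE hn (recPoly (gramCoeff n) m)
  rw [← h, sq_abs, ← sum_gram_sq n hn]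
  exact Finset.single_le_sum (f := fun i => (recPoly (gramCoeff n) m).eval (gridPt n i) ^ 2)
    (fun i _ => sq_nonneg _) (Finset.mem_range.mpr hj)

theorem prod_gramCoeff_pos {n m : ℕ} (hm : m < n) :
    0 < ∏ k ∈ Finset.range m, gramCoeff n (k + 1) :=
  Finset.prod_pos fun k hk => gramCoeff_pos (by omega) (by have := Finset.mem_range.mp hk; omega)

theorem prod_gramCoeff_antitone {n j m : ℕ} (hjm : j ≤ m) (hm : m < n) :
    ∏ k ∈ Finset.range m, gramCoeff n (k + 1) ≤ ∏ k ∈ Finset.range j, gramCoeff n (k + 1) := by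
  induction m, hjm using Nat.le_induction with
  | base => rfl
  | succ m hjm ih =>
    refine le_trans ?_ (ih (by omega))
    rw [Finset.prod_range_succ]
    exact mul_le_of_le_one_right (prod_gramCoeff_pos (by omega)).le
      (gramCoeff_le_one (by omega) (by omega))

theorem prod_gramCoeff_le_normE_sq {n : ℕ} (hn : 2 ≤ n) {p : ℝ[X]} (hp : p.Monic)
    (hd : p.natDegree < n) :
    ∏ k ∈ Finset.range p.natDegree, gramCoeff n (k + 1) ≤ normE n p ^ 2 := by
  obtain ⟨a, ha1, ha⟩ := exists_recPoly_expansion_monic (gramCoeff n) hp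
  have h := sum_sq_le_normE hn p
  conv_lhs at h => rw [ha]
  rw [sum_sq_eval_expansion hn] at h
  have h2 := Finset.single_le_sum (f := fun j => a j ^ 2 * (n * ∏ k ∈ Finset.range j,
    gramCoeff n (k + 1))) (s := Finset.range (p.natDegree + 1)) (a := p.natDegree) (fun j hj => by
      have := (prod_gramCoeff_pos (n := n) (m := j) (by have := Finset.mem_range.mp hj; omega)).le
      positivity) (by simp)
  rw [ha1, one_pow, one_mul] at h2
  exact le_of_mul_le_mul_left (h2.trans h) (by positivity)

/-- The coefficients of a near-minimal polynomial in the Gram basis are at most `√n`. -/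
theorem expansion_coeff_sq_le {n m : ℕ} (hn : 2 ≤ n) (hm : m < n) (a : ℕ → ℝ)
    (h : normE n (∑ j ∈ Finset.range (m + 1), C (a j) * recPoly (gramCoeff n) j) ≤
      normE n (recPoly (gramCoeff n) m)) {j : ℕ} (hj : j ≤ m) : a j ^ 2 ≤ n := by
  set p := ∑ j ∈ Finset.range (m + 1), C (a j) * recPoly (gramCoeff n) j with hp
  have h1 := sum_sq_le_normE hn p
  rw [hp, sum_sq_eval_expansion hn, ← hp] at h1
  have h2 := Finset.single_le_sum (f := fun j => a j ^ 2 * (n * ∏ k ∈ Finset.range j,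
    gramCoeff n (k + 1))) (s := Finset.range (m + 1)) (a := j) (fun j hj => by
      have := (prod_gramCoeff_pos (n := n) (m := j) (by have := Finset.mem_range.mp hj; omega)).le
      positivity) (by simp; omega)
  have h0 : 0 ≤ normE n p := by
    obtain ⟨i, -, hi⟩ := exists_abs_eval_eq_normE hn p
    rw [← hi]; exact abs_nonneg _
  have h3 : normE n p ^ 2 ≤ n * ∏ k ∈ Finset.range j, gramCoeff n (k + 1) := by
    calc normE n p ^ 2 ≤ normE n (recPoly (gramCoeff n) m) ^ 2 := by gcongr
      _ ≤ _ := normE_gram_sq_le hn m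
      _ ≤ _ := by gcongr ?_ * ?_; exact prod_gramCoeff_antitone hj hm
  have hpos : 0 < (n : ℝ) * ∏ k ∈ Finset.range j, gramCoeff n (k + 1) :=
    mul_pos (by positivity) (prod_gramCoeff_pos (by omega))
  refine le_of_mul_le_mul_right ((h2.trans h1).trans ?_) hpos
  gcongr

/-- The ratios `w * T (k+1) (1/w) / T k (1/w)` of consecutive reversed recurrence polynomials. -/
noncomputable def ratioC (c : ℕ → ℝ) (w : ℂ) : ℕ → ℂ
  | 0 => 1
  | k + 1 => 1 - c (k + 1) * w ^ 2 / ratioC c w k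

theorem norm_ratioC_sub_one_le {c : ℕ → ℝ} {N : ℕ} (hc : ∀ k, 1 ≤ k → k < N → |c k| ≤ 1)
    {w : ℂ} (hw : ‖w‖ ≤ 1 / 4) {k : ℕ} (hk : k < N) : ‖ratioC c w k - 1‖ ≤ 1 / 8 := by
  induction k with
  | zero => simp [ratioC]
  | succ k ih =>
    have h := ih (by omega)
    have h1 : 7 / 8 ≤ ‖ratioC c w k‖ := by
      have := norm_sub_norm_le (1 : ℂ) (1 - ratioC c w k)
      rw [norm_sub_rev 1 (ratioC c w k), norm_one, sub_sub_cancel] at this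
      linarith
    rw [ratioC, sub_sub_cancel_left, norm_neg, norm_div, norm_mul, norm_pow, Complex.norm_real,
      Real.norm_eq_abs, div_le_iff₀ (by linarith)]
    have h2 := hc (k + 1) (by omega) hk
    have h3 : ‖w‖ ^ 2 ≤ (1 / 4) ^ 2 := by gcongr
    have h4 : |c (k + 1)| * ‖w‖ ^ 2 ≤ 1 * (1 / 4) ^ 2 := by gcongr
    linarith

theorem le_norm_ratioC {c : ℕ → ℝ} {N : ℕ} (hc : ∀ k, 1 ≤ k → k < N → |c k| ≤ 1)
    {w : ℂ} (hw : ‖w‖ ≤ 1 / 4) {k : ℕ} (hk : k < N) : 7 / 8 ≤ ‖ratioC c w k‖ := by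
  have h := norm_ratioC_sub_one_le hc hw hk
  have := norm_sub_norm_le (1 : ℂ) (1 - ratioC c w k)
  rw [norm_sub_rev 1 (ratioC c w k), norm_one, sub_sub_cancel] at this
  linarith

theorem ratioC_mem_slitPlane {c : ℕ → ℝ} {N : ℕ} (hc : ∀ k, 1 ≤ k → k < N → |c k| ≤ 1)
    {w : ℂ} (hw : ‖w‖ ≤ 1 / 4) {k : ℕ} (hk : k < N) : ratioC c w k ∈ Complex.slitPlane := by
  have h := (Complex.abs_re_le_norm _).trans (norm_ratioC_sub_one_le hc hw hk)
  rw [Complex.sub_re, Complex.one_re, abs_le] at h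
  exact Or.inl (by linarith [h.1])

theorem pow_mul_recPoly_eq_prod_ratioC {c : ℕ → ℝ} {N : ℕ}
    (hc : ∀ k, 1 ≤ k → k < N → |c k| ≤ 1) {w : ℂ} (hw : ‖w‖ ≤ 1 / 4) (hw0 : w ≠ 0) {k : ℕ}
    (hk : k ≤ N) : w ^ k * aeval w⁻¹ (recPoly c k) = ∏ i ∈ Finset.range k, ratioC c w i := by
  induction k using Nat.twoStepInduction with
  | zero => simp [recPoly]
  | one => simp [recPoly, ratioC, hw0]
  | more k ih1 ih2 =>
    have h1 := ih1 (by omega)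
    have h2 := ih2 (by omega)
    have hne : ratioC c w k ≠ 0 := by
      rw [← norm_pos_iff]
      linarith [le_norm_ratioC hc hw (show k < N by omega)]
    rw [Finset.prod_range_succ, ← h2]
    rw [Finset.prod_range_succ, ← h1] at h2
    rw [recPoly, ratioC, map_sub, map_mul, map_mul, aeval_X, aeval_C, Complex.coe_algebraMap]
    have e : w ^ (k + 2) * (w⁻¹ * aeval w⁻¹ (recPoly c (k + 1))) =
        w ^ (k + 1) * aeval w⁻¹ (recPoly c (k + 1)) := by
      rw [pow_succ w (k + 1), mul_assoc, mul_inv_cancel_left₀ hw0]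
    rw [mul_sub, e, mul_sub, mul_one]
    congr 1
    rw [h2]
    field_simp
    ring

theorem norm_pow_mul_aeval_le {n m : ℕ} (hn : 2 ≤ n) (hm : m < n) (a : ℕ → ℝ)
    (ha : ∀ j ≤ m, a j ^ 2 ≤ n) {w : ℂ} (hw : ‖w‖ ≤ 1 / 4) (hw0 : w ≠ 0) :
    ‖w ^ m * aeval w⁻¹ (∑ j ∈ Finset.range (m + 1), C (a j) * recPoly (gramCoeff n) j)‖ ≤
      2 * √n * ‖∏ i ∈ Finset.range m, ratioC (gramCoeff n) w i‖ := by
  have hc : ∀ k, 1 ≤ k → k < n → |gramCoeff n k| ≤ 1 := fun k h1 h2 => by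
    rw [abs_of_pos (gramCoeff_pos h1 h2)]; exact gramCoeff_le_one h1 h2
  set A : ℕ → ℂ := fun k => ∏ i ∈ Finset.range k, ratioC (gramCoeff n) w i with hA
  have hgrow : ∀ i, ∀ j, j + i ≤ m → ‖A j‖ ≤ 2 ^ i * ‖A (j + i)‖ := by
    intro i
    induction i with
    | zero => intro j _; simp
    | succ i ih =>
      intro j hj
      refine (ih j (by omega)).trans ?_
      have h1 : A (j + (i + 1)) = A (j + i) * ratioC (gramCoeff n) w (j + i) := by
        rw [← add_assoc]; exact Finset.prod_range_succ _ _
      rw [h1, norm_mul, pow_succ]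
      have h2 := le_norm_ratioC hc hw (show j + i < n by omega)
      have h3 : 0 ≤ (2 : ℝ) ^ i * ‖A (j + i)‖ := by positivity
      nlinarith
  rw [map_sum, Finset.mul_sum]
  refine (norm_sum_le _ _).trans ?_
  have hterm : ∀ j ∈ Finset.range (m + 1), ‖w ^ m * aeval w⁻¹ (C (a j) * recPoly (gramCoeff n) j)‖
      ≤ √n * ‖A m‖ * (1 / 2) ^ (m - j) := by
    intro j hj
    have hjm : j ≤ m := by have := Finset.mem_range.mp hj; omega
    have e : w ^ m * aeval w⁻¹ (C (a j) * recPoly (gramCoeff n) j) =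
        a j * w ^ (m - j) * A j := by
      simp only [hA]
      rw [← pow_mul_recPoly_eq_prod_ratioC hc hw hw0 (hjm.trans hm.le), map_mul, aeval_C,
        Complex.coe_algebraMap]
      conv_lhs => rw [← Nat.sub_add_cancel hjm, pow_add]
      ring
    rw [e, norm_mul, norm_mul, norm_pow, Complex.norm_real, Real.norm_eq_abs]
    have h1 : |a j| ≤ √n := Real.abs_le_sqrt (ha j hjm)
    have h2 := hgrow (m - j) j (by omega)
    rw [Nat.add_sub_cancel' hjm] at h2
    calc |a j| * ‖w‖ ^ (m - j) * ‖A j‖ ≤ √n * (1 / 4) ^ (m - j) * (2 ^ (m - j) * ‖A m‖) := by gcongr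
      _ = √n * ‖A m‖ * ((1 / 4) * 2) ^ (m - j) := by rw [mul_pow]; ring
      _ = _ := by norm_num
  refine (Finset.sum_le_sum hterm).trans ?_
  rw [← Finset.mul_sum]
  have hgeo : ∑ j ∈ Finset.range (m + 1), ((1 : ℝ) / 2) ^ (m - j) ≤ 2 := by
    have := Finset.sum_range_reflect (fun j => ((1 : ℝ) / 2) ^ j) (m + 1)
    simp only [add_tsub_cancel_right] at this
    rw [this]
    exact sum_geometric_two_le _
  calc √n * ‖A m‖ * ∑ j ∈ Finset.range (m + 1), ((1 : ℝ) / 2) ^ (m - j)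
      ≤ √n * ‖A m‖ * 2 := by gcongr
    _ = _ := by ring

/-- Real version of `ratioC`. -/
noncomputable def ratioR (c : ℕ → ℝ) (w : ℝ) : ℕ → ℝ
  | 0 => 1
  | k + 1 => 1 - c (k + 1) * w ^ 2 / ratioR c w k

theorem ofReal_ratioR (c : ℕ → ℝ) (w : ℝ) (k : ℕ) : (ratioR c w k : ℂ) = ratioC c w k := by
  induction k with
  | zero => simp [ratioR, ratioC]
  | succ k ih => simp [ratioR, ratioC, ← ih]

theorem abs_ratioR_sub_one_le {c : ℕ → ℝ} {N : ℕ} (hc : ∀ k, 1 ≤ k → k < N → |c k| ≤ 1)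
    {w : ℝ} (hw : |w| ≤ 1 / 4) {k : ℕ} (hk : k < N) : |ratioR c w k - 1| ≤ 1 / 8 := by
  have h := norm_ratioC_sub_one_le hc (w := (w : ℂ)) (by simpa using hw) hk
  rw [← ofReal_ratioR] at h
  rw [← Real.norm_eq_abs, ← Complex.norm_real]
  simpa using h

theorem one_sub_mul_mem_slitPlane {x : ℝ} (hx : x ∈ Icc (-1 : ℝ) 1) {w : ℂ} (hw : ‖w‖ < 1) :
    1 - x * w ∈ Complex.slitPlane := by
  have h1 : ‖(x : ℂ) * w‖ < 1 := by
    rw [norm_mul, Complex.norm_real, Real.norm_eq_abs]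
    have := abs_le.mpr hx
    nlinarith [norm_nonneg w, abs_nonneg x]
  have h2 := (Complex.abs_re_le_norm _).trans_lt h1
  refine Or.inl ?_
  rw [Complex.sub_re, Complex.one_re]
  linarith [(abs_lt.mp h2).2]

theorem differentiableOn_sum_log (s : Multiset ℝ) (hs : ∀ x ∈ s, x ∈ Icc (-1 : ℝ) 1) :
    DifferentiableOn ℂ (fun w => (s.map fun x : ℝ => Complex.log (1 - x * w)).sum)
      (Metric.ball 0 (1 / 4)) := by
  induction s using Multiset.induction with
  | empty => simp
  | cons a s ih =>
    simp only [Multiset.map_cons, Multiset.sum_cons]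
    refine DifferentiableOn.add ?_ (ih fun x hx => hs x (Multiset.mem_cons_of_mem hx))
    refine DifferentiableOn.clog (by fun_prop) fun w hw => ?_
    refine one_sub_mul_mem_slitPlane (hs a (Multiset.mem_cons_self a s)) ?_
    rw [mem_ball_zero_iff] at hw
    linarith

theorem exp_sum_log (s : Multiset ℝ) (hs : ∀ x ∈ s, x ∈ Icc (-1 : ℝ) 1) {w : ℂ} (hw : ‖w‖ < 1) :
    Complex.exp (s.map fun x : ℝ => Complex.log (1 - x * w)).sum =
      (s.map fun x : ℝ => 1 - x * w).prod := by
  induction s using Multiset.induction with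
  | empty => simp
  | cons a s ih =>
    simp only [Multiset.map_cons, Multiset.sum_cons, Multiset.prod_cons]
    rw [Complex.exp_add, ih fun x hx => hs x (Multiset.mem_cons_of_mem hx), Complex.exp_log]
    exact Complex.slitPlane_ne_zero
      (one_sub_mul_mem_slitPlane (hs a (Multiset.mem_cons_self a s)) hw)

theorem sum_log_ofReal (s : Multiset ℝ) (hs : ∀ x ∈ s, x ∈ Icc (-1 : ℝ) 1) {w : ℝ} (hw : |w| < 1) :
    (s.map fun x : ℝ => Complex.log (1 - x * w)).sum =
      ((s.map fun x : ℝ => Real.log (1 - x * w)).sum : ℝ) := by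
  induction s using Multiset.induction with
  | empty => simp
  | cons a s ih =>
    simp only [Multiset.map_cons, Multiset.sum_cons]
    rw [ih fun x hx => hs x (Multiset.mem_cons_of_mem hx), Complex.ofReal_add, Complex.ofReal_log]
    · push_cast; rfl
    · have := one_sub_mul_mem_slitPlane (hs a (Multiset.mem_cons_self a s)) (w := (w : ℂ))
        (by simpa using hw)
      rw [show (1 - (a : ℂ) * w) = ((1 - a * w : ℝ) : ℂ) by push_cast; rfl,
        Complex.ofReal_mem_slitPlane] at this
      exact this.le

theorem pow_card_mul_aeval_prod (s : Multiset ℝ) {w : ℂ} (hw : w ≠ 0) :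
    w ^ s.card * aeval w⁻¹ (s.map fun a : ℝ => X - C a).prod =
      (s.map fun x : ℝ => 1 - x * w).prod := by
  induction s using Multiset.induction with
  | empty => simp
  | cons a s ih =>
    simp only [Multiset.map_cons, Multiset.prod_cons, Multiset.card_cons]
    rw [← ih, map_mul, map_sub, aeval_X, aeval_C, Complex.coe_algebraMap, pow_succ]
    field_simp

theorem differentiableOn_ratioC {c : ℕ → ℝ} {N : ℕ} (hc : ∀ k, 1 ≤ k → k < N → |c k| ≤ 1)
    {k : ℕ} (hk : k < N) : DifferentiableOn ℂ (fun w => ratioC c w k) (Metric.ball 0 (1 / 4)) := by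
  induction k with
  | zero => simp [ratioC]
  | succ k ih =>
    simp only [ratioC]
    refine DifferentiableOn.const_sub (DifferentiableOn.fun_div (by fun_prop) (ih (by omega)) ?_) _
    intro w hw
    rw [mem_ball_zero_iff] at hw
    exact Complex.slitPlane_ne_zero (ratioC_mem_slitPlane hc hw.le (by omega))

/-- The logarithmic potential of the zeros of a minimal polynomial agrees, up to `O(log n)`, with
that of the Gram polynomial of the same degree. -/
theorem abs_sum_log_roots_sub_le {n : ℕ} (hn : 2 ≤ n) {p : ℝ[X]} (hp : p.Monic)
    (hd : p.natDegree < n)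
    (hmin : ∀ Q : ℝ[X], Q.Monic → Q.natDegree = p.natDegree → normE n p ≤ normE n Q)
    {w : ℝ} (hw0 : 0 < w) (hw : w ≤ 1 / 8) :
    |(p.roots.map fun x => Real.log (1 - x * w)).sum -
      ∑ k ∈ Finset.range p.natDegree, Real.log (ratioR (gramCoeff n) w k)| ≤
      2 * Real.log (2 * √n) := by
  have hroots := minimal_roots_mem_Icc hn hp hd hmin
  obtain ⟨hprod, hcard⟩ := minimal_eq_prod_roots hn hp hd hmin
  have hc : ∀ k, 1 ≤ k → k < n → |gramCoeff n k| ≤ 1 := fun k h1 h2 => by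
    rw [abs_of_pos (gramCoeff_pos h1 h2)]; exact gramCoeff_le_one h1 h2
  set m := p.natDegree with hm
  have hsqrt : 1 ≤ √(n : ℝ) := Real.one_le_sqrt.mpr (by exact_mod_cast (by omega : 1 ≤ n))
  have hM : 0 < Real.log (2 * √n) := Real.log_pos (by linarith)
  set F : ℂ → ℂ := fun w => (p.roots.map fun x : ℝ => Complex.log (1 - x * w)).sum with hF
  set G : ℂ → ℂ := fun w => ∑ k ∈ Finset.range m, Complex.log (ratioC (gramCoeff n) w k) with hG
  have hFd : DifferentiableOn ℂ F (Metric.ball 0 (1 / 4)) := differentiableOn_sum_log _ hroots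
  have hGd : DifferentiableOn ℂ G (Metric.ball 0 (1 / 4)) := by
    refine DifferentiableOn.fun_sum fun k hk => ?_
    have hk' : k < n := (Finset.mem_range.mp hk).trans hd
    refine DifferentiableOn.clog (differentiableOn_ratioC hc hk') fun w hw => ?_
    rw [mem_ball_zero_iff] at hw
    exact ratioC_mem_slitPlane hc hw.le hk'
  have hGe : ∀ w : ℂ, ‖w‖ < 1 / 4 →
      Complex.exp (G w) = ∏ k ∈ Finset.range m, ratioC (gramCoeff n) w k := by
    intro w hw
    simp only [hG]
    rw [Complex.exp_sum]
    refine Finset.prod_congr rfl fun k hk => Complex.exp_log ?_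
    exact Complex.slitPlane_ne_zero
      (ratioC_mem_slitPlane hc hw.le ((Finset.mem_range.mp hk).trans hd))
  have hbound : ∀ w : ℂ, ‖w‖ < 1 / 4 → ‖Complex.exp (F w)‖ ≤ 2 * √n * ‖Complex.exp (G w)‖ := by
    intro w hw
    by_cases h0 : w = 0
    · have hr : ∀ k, ratioC (gramCoeff n) 0 k = 1 := by intro k; cases k <;> simp [ratioC]
      subst h0
      simp only [hF, hG, hr]
      simp
      linarith
    · rw [hGe w hw, hF, exp_sum_log _ hroots (by linarith), ← pow_card_mul_aeval_prod _ h0, hprod,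
        hcard]
      obtain ⟨a, -, ha⟩ := exists_recPoly_expansion_monic (gramCoeff n) hp
      have hle := hmin _ (recPoly_monic (gramCoeff n) m) (natDegree_recPoly _ _)
      conv_lhs => rw [ha]
      refine norm_pow_mul_aeval_le hn hd a (fun j hj => ?_) hw.le h0
      refine expansion_coeff_sq_le hn hd a ?_ hj
      rw [← hm] at ha
      rwa [← ha]
  have hBC := Complex.borelCaratheodory_zero (f := fun w => F w - G w) (R := 1 / 4) (z := (w : ℂ))
    hM (hFd.sub hGd) ?_ (by norm_num) ?_ ?_
  · have e : F w - G w = (((p.roots.map fun x => Real.log (1 - x * w)).sum -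
        ∑ k ∈ Finset.range m, Real.log (ratioR (gramCoeff n) w k) : ℝ) : ℂ) := by
      simp only [hF, hG]
      rw [sum_log_ofReal _ hroots (by rw [abs_of_pos hw0]; linarith), Complex.ofReal_sub,
        Complex.ofReal_sum]
      congr 1
      refine Finset.sum_congr rfl fun k hk => ?_
      have h8 := abs_ratioR_sub_one_le hc (w := w) (by rw [abs_of_pos hw0]; linarith)
        ((Finset.mem_range.mp hk).trans hd)
      rw [Complex.ofReal_log (by linarith [(abs_le.mp h8).1]), ofReal_ratioR]
    rw [e, Complex.norm_real, Complex.norm_real, Real.norm_eq_abs, Real.norm_eq_abs,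
      abs_of_pos hw0] at hBC
    refine hBC.trans ?_
    rw [div_le_iff₀ (by linarith)]
    nlinarith
  · intro z hz
    rw [mem_ball_zero_iff] at hz
    have h := hbound z hz
    rw [Complex.norm_exp, Complex.norm_exp] at h
    change (F z - G z).re ≤ _
    rw [Complex.sub_re, sub_le_iff_le_add, ← Real.exp_le_exp, Real.exp_add,
      Real.exp_log (by positivity)]
    exact h
  · rw [mem_ball_zero_iff, Complex.norm_real, Real.norm_eq_abs, abs_of_pos hw0]
    linarith
  · have hr : ∀ k, ratioC (gramCoeff n) 0 k = 1 := by intro k; cases k <;> simp [ratioC]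
    simp [hF, hG, hr]

/-- The limit of `gramCoeff n k` as `n → ∞` and `k / n → s`. -/
noncomputable def gramLimit (s : ℝ) : ℝ := (1 - s ^ 2) / 4

/-- The limit of `ratioR (gramCoeff n) w k` as `n → ∞` and `k / n → s`. -/
noncomputable def ratioLimit (w s : ℝ) : ℝ := (1 + √(1 - (1 - s ^ 2) * w ^ 2)) / 2

/-- Relative error bound in the approximation of `gramCoeff n k` by `gramLimit (k / n)`. -/
noncomputable def gramError (n k : ℕ) : ℝ := 5 / (4 * (k : ℝ) ^ 2 - 1) + 8 / n

theorem half_le_ratioLimit (w s : ℝ) : 1 / 2 ≤ ratioLimit w s := by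
  unfold ratioLimit
  linarith [Real.sqrt_nonneg (1 - (1 - s ^ 2) * w ^ 2)]

theorem ratioLimit_le_one {w s : ℝ} (hs : s ^ 2 ≤ 1) : ratioLimit w s ≤ 1 := by
  unfold ratioLimit
  have : √(1 - (1 - s ^ 2) * w ^ 2) ≤ 1 := by
    refine Real.sqrt_le_one.2 ?_
    nlinarith [mul_nonneg (sub_nonneg.2 hs) (sq_nonneg w)]
  linarith

theorem monotoneOn_ratioLimit (w : ℝ) : MonotoneOn (ratioLimit w) (Ici 0) := by
  intro s hs t _ hst
  have : s ^ 2 ≤ t ^ 2 := pow_le_pow_left₀ hs hst 2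
  have h2 : √(1 - (1 - s ^ 2) * w ^ 2) ≤ √(1 - (1 - t ^ 2) * w ^ 2) := by
    apply Real.sqrt_le_sqrt
    nlinarith [mul_nonneg (sub_nonneg.2 this) (sq_nonneg w)]
  unfold ratioLimit
  linarith

theorem ratioLimit_eq {w s : ℝ} (hw : w ^ 2 ≤ 1) :
    ratioLimit w s = 1 - gramLimit s * w ^ 2 / ratioLimit w s := by
  have h0 : ratioLimit w s ≠ 0 := by linarith [half_le_ratioLimit w s]
  have hs := Real.sq_sqrt (show 0 ≤ 1 - (1 - s ^ 2) * w ^ 2 by nlinarith [mul_nonneg (sq_nonneg s) (sq_nonneg w)])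
  rw [eq_sub_iff_add_eq, ← eq_sub_iff_add_eq', div_eq_iff h0]
  unfold ratioLimit gramLimit
  linarith

theorem gramError_nonneg (n : ℕ) {k : ℕ} (hk : 1 ≤ k) : 0 ≤ gramError n k := by
  have hk' : (1 : ℝ) ≤ k := by exact_mod_cast hk
  have : 0 < 4 * (k : ℝ) ^ 2 - 1 := by nlinarith
  unfold gramError
  positivity

theorem sum_gramError_le {n m : ℕ} (hm : m ≤ n) :
    ∑ k ∈ Finset.range m, gramError n (k + 1) ≤ 11 := by
  have h : ∀ j : ℕ, ∑ k ∈ Finset.range j, gramError n (k + 1) =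
      5 / 2 * (1 - 1 / (2 * (j : ℝ) + 1)) + j * (8 / n) := by
    intro j
    induction j with
    | zero => simp
    | succ j ih =>
      rw [Finset.sum_range_succ, ih]
      have h1 : 2 * (j : ℝ) + 1 ≠ 0 := by positivity
      have h2 : 2 * (j : ℝ) + 3 ≠ 0 := by positivity
      have h3 : 4 * ((j : ℝ) + 1) ^ 2 - 1 ≠ 0 := by
        rw [show 4 * ((j : ℝ) + 1) ^ 2 - 1 = (2 * j + 1) * (2 * j + 3) by ring]
        positivity
      have h4 : 2 * ((j : ℝ) + 1) + 1 = 2 * j + 3 := by ring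
      unfold gramError
      push_cast
      rw [show 4 * ((j : ℝ) + 1) ^ 2 - 1 = (2 * j + 1) * (2 * j + 3) by ring, h4]
      generalize (8 : ℝ) / n = e
      field_simp
      ring
  rw [h]
  have h1 : 0 ≤ 1 / (2 * (m : ℝ) + 1) := by positivity
  have h2 : (m : ℝ) * (8 / n) ≤ 8 := by
    rcases Nat.eq_zero_or_pos n with rfl | hn
    · simp
    have hn' : (0 : ℝ) < n := by exact_mod_cast hn
    rw [← mul_div_assoc, div_le_iff₀ hn']
    have : (m : ℝ) ≤ n := by exact_mod_cast hm
    linarith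
  linarith

theorem exists_gramCoeff_eq {n k : ℕ} (hn : 2 ≤ n) (hk : 1 ≤ k) :
    ∃ e, 0 ≤ e ∧ e ≤ gramError n k ∧ gramCoeff n k = gramLimit (k / n) * (1 + e) := by
  have hk' : (1 : ℝ) ≤ k := by exact_mod_cast hk
  have hn' : (2 : ℝ) ≤ n := by exact_mod_cast hn
  have h1 : 0 < 4 * (k : ℝ) ^ 2 - 1 := by nlinarith
  have h2 : 0 < (n : ℝ) - 1 := by linarith
  set a : ℝ := 1 / (4 * (k : ℝ) ^ 2 - 1) with ha
  set b : ℝ := (2 * n - 1) / ((n : ℝ) - 1) ^ 2 with hb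
  have ha0 : 0 ≤ a := by positivity
  have hb0 : 0 ≤ b := by
    apply div_nonneg <;> nlinarith
  have hbn : b ≤ 8 / n := by
    rw [hb, div_le_div_iff₀ (by positivity) (by linarith)]
    nlinarith
  have hb4 : b ≤ 4 := by
    refine hbn.trans ?_
    rw [div_le_iff₀ (by linarith)]
    linarith
  refine ⟨a + b + a * b, by positivity, ?_, ?_⟩
  · have : gramError n k = 5 * a + 8 / n := by
      rw [gramError, ha]
      ring
    nlinarith
  · have e : 1 + (a + b + a * b) = (4 * (k : ℝ) ^ 2 / (4 * k ^ 2 - 1)) * (n ^ 2 / (n - 1) ^ 2) := by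
      have e1 : 1 + a = 4 * (k : ℝ) ^ 2 / (4 * k ^ 2 - 1) := by
        rw [ha]; field_simp; ring
      have e2 : 1 + b = (n : ℝ) ^ 2 / (n - 1) ^ 2 := by
        rw [hb]; field_simp; ring
      rw [← e1, ← e2]
      ring
    rw [e]
    unfold gramCoeff gramLimit
    have h0 : (n : ℝ) ≠ 0 := by linarith
    field_simp

theorem sq_div_lt_one {n k : ℕ} (hk : k < n) : ((k : ℝ) / n) ^ 2 < 1 := by
  have hn' : (0 : ℝ) < n := by exact_mod_cast (Nat.zero_le k).trans_lt hk
  have : (k : ℝ) < n := by exact_mod_cast hk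
  rw [sq_lt_one_iff₀ (by positivity), div_lt_one hn']
  exact this

theorem abs_gramCoeff_sub_le {n k : ℕ} (hn : 2 ≤ n) (hk : 1 ≤ k) (hkn : k < n) :
    |gramCoeff n k - gramLimit (k / n)| ≤ gramError n k := by
  obtain ⟨e, h0, h1, h2⟩ := exists_gramCoeff_eq hn hk
  have h3 := sq_div_lt_one hkn
  rw [h2, show ∀ x : ℝ, x * (1 + e) - x = x * e by intro x; ring, gramLimit, abs_of_nonneg]
  · nlinarith [sq_nonneg ((k : ℝ) / n)]
  · apply mul_nonneg _ h0
    linarith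

theorem abs_log_gramCoeff_sub_le {n k : ℕ} (hn : 2 ≤ n) (hk : 1 ≤ k) (hkn : k < n) :
    |Real.log (gramCoeff n k) - Real.log (gramLimit (k / n))| ≤ gramError n k := by
  obtain ⟨e, h0, h1, h2⟩ := exists_gramCoeff_eq hn hk
  have h3 := sq_div_lt_one hkn
  have h4 : gramLimit (k / n) ≠ 0 := by
    unfold gramLimit
    linarith
  rw [h2, Real.log_mul h4 (by linarith), add_sub_cancel_left,
    abs_of_nonneg (Real.log_nonneg (by linarith))]
  linarith [Real.log_le_sub_one_of_pos (show 0 < 1 + e by linarith)]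

theorem abs_log_sub_log_le {x y : ℝ} (hx : 1 / 2 ≤ x) (hy : 1 / 2 ≤ y) :
    |Real.log x - Real.log y| ≤ 2 * |x - y| := by
  wlog h : y ≤ x generalizing x y
  · rw [abs_sub_comm, abs_sub_comm x]
    exact this hy hx (le_of_not_ge h)
  have hy0 : 0 < y := by linarith
  have hx0 : 0 < x := by linarith
  rw [abs_of_nonneg (sub_nonneg.2 (Real.log_le_log hy0 h)), abs_of_nonneg (sub_nonneg.2 h),
    ← Real.log_div hx0.ne' hy0.ne']
  refine (Real.log_le_sub_one_of_pos (div_pos hx0 hy0)).trans ?_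
  rw [div_sub_one hy0.ne', div_le_iff₀ hy0]
  nlinarith

theorem half_le_ratioR_gramCoeff {n k : ℕ} (hk : k < n) {w : ℝ} (hw0 : 0 < w)
    (hw : w ≤ 1 / 8) : 1 / 2 ≤ ratioR (gramCoeff n) w k := by
  have h := abs_ratioR_sub_one_le (c := gramCoeff n) (N := n) (w := w)
    (fun k hk hkn => by
      rw [abs_of_pos (gramCoeff_pos hk hkn)]
      exact gramCoeff_le_one hk hkn) (by rw [abs_of_pos hw0]; linarith) hk
  linarith [(abs_le.mp h).1]

theorem abs_ratioR_succ_sub_le {n k : ℕ} (hn : 2 ≤ n) (hk : k + 1 < n) {w : ℝ} (hw0 : 0 < w)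
    (hw : w ≤ 1 / 8) :
    |ratioR (gramCoeff n) w (k + 1) - ratioLimit w ((k + 1 : ℕ) / n)| ≤
      1 / 2 * |ratioR (gramCoeff n) w k - ratioLimit w (k / n)| + gramError n (k + 1) +
        (ratioLimit w ((k + 1 : ℕ) / n) - ratioLimit w (k / n)) := by
  have hx := half_le_ratioR_gramCoeff (show k < n by omega) hw0 hw
  have hy := half_le_ratioLimit w ((k + 1 : ℕ) / n)
  have hc := abs_gramCoeff_sub_le hn (show 1 ≤ k + 1 by omega) hk
  have hE := gramError_nonneg n (show 1 ≤ k + 1 by omega)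
  have hmono : ratioLimit w (k / n) ≤ ratioLimit w ((k + 1 : ℕ) / n) := by
    apply monotoneOn_ratioLimit w
    · simp only [mem_Ici]; positivity
    · simp only [mem_Ici]; positivity
    · gcongr
      omega
  have hs := sq_div_lt_one hk
  have hl : |gramLimit ((k + 1 : ℕ) / n)| ≤ 1 / 4 := by
    unfold gramLimit
    rw [abs_of_nonneg (by linarith)]
    linarith [sq_nonneg (((k + 1 : ℕ) : ℝ) / n)]
  rw [ratioR]
  nth_rw 1 [ratioLimit_eq (show w ^ 2 ≤ 1 by nlinarith)]
  set x := ratioR (gramCoeff n) w k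
  set y := ratioLimit w ((k + 1 : ℕ) / n)
  set z := ratioLimit w (k / n)
  set c := gramCoeff n (k + 1)
  set l := gramLimit ((k + 1 : ℕ) / n)
  have hx0 : x ≠ 0 := by linarith
  have hy0 : y ≠ 0 := by linarith
  have e : 1 - c * w ^ 2 / x - (1 - l * w ^ 2 / y) =
      -(w ^ 2 / x) * (c - l) - l * (w ^ 2 / (x * y)) * ((y - z) - (x - z)) := by
    field_simp
    ring
  have hwx : w ^ 2 / x ≤ 1 / 32 := by
    rw [div_le_iff₀ (by linarith)]
    nlinarith
  have hwxy : w ^ 2 / (x * y) ≤ 1 / 16 := by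
    rw [div_le_iff₀ (by positivity)]
    nlinarith [mul_nonneg (sub_nonneg.2 hx) (sub_nonneg.2 hy)]
  have hwx0 : 0 ≤ w ^ 2 / x := by positivity
  have hwxy0 : 0 ≤ w ^ 2 / (x * y) := by positivity
  rw [e]
  calc _ ≤ |-(w ^ 2 / x) * (c - l)| + |l * (w ^ 2 / (x * y)) * ((y - z) - (x - z))| := abs_sub _ _
    _ ≤ 1 / 32 * gramError n (k + 1) + 1 / 4 * (1 / 16) * (|y - z| + |x - z|) := by
      rw [abs_mul, abs_neg, abs_of_nonneg hwx0, abs_mul, abs_mul, abs_of_nonneg hwxy0]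
      gcongr
      exact abs_sub _ _
    _ ≤ _ := by
      rw [abs_of_nonneg (sub_nonneg.2 hmono)]
      have := abs_nonneg (x - z)
      linarith

theorem sum_abs_ratioR_sub_add_le {n k : ℕ} (hn : 2 ≤ n) (hk : k < n) {w : ℝ} (hw0 : 0 < w)
    (hw : w ≤ 1 / 8) :
    ∑ j ∈ Finset.range (k + 1), |ratioR (gramCoeff n) w j - ratioLimit w (j / n)| +
        |ratioR (gramCoeff n) w k - ratioLimit w (k / n)| ≤
      2 + 2 * ∑ j ∈ Finset.range k, gramError n (j + 1) +
        2 * (ratioLimit w (k / n) - ratioLimit w 0) := by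
  induction k with
  | zero =>
    have h1 := half_le_ratioLimit w 0
    have h2 := ratioLimit_le_one (w := w) (s := 0) (by norm_num)
    have h3 : |1 - ratioLimit w 0| ≤ 1 := by
      rw [abs_of_nonneg (by linarith)]
      linarith
    simp only [zero_add, Finset.sum_range_one, ratioR, CharP.cast_eq_zero, zero_div,
      Finset.sum_range_zero]
    linarith
  | succ k ih =>
    rw [Finset.sum_range_succ _ (k + 1), Finset.sum_range_succ (fun j => gramError n (j + 1)) k]
    have h1 := ih (by omega)
    have h2 := abs_ratioR_succ_sub_le hn hk hw0 hw
    linarith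

theorem abs_sum_log_ratioR_sub_le {n m : ℕ} (hn : 2 ≤ n) (hm : m < n) {w : ℝ} (hw0 : 0 < w)
    (hw : w ≤ 1 / 8) :
    |∑ k ∈ Finset.range m, Real.log (ratioR (gramCoeff n) w k) -
      ∑ k ∈ Finset.range m, Real.log (ratioLimit w (k / n))| ≤ 52 := by
  rw [← Finset.sum_sub_distrib]
  calc _ ≤ ∑ k ∈ Finset.range m, |Real.log (ratioR (gramCoeff n) w k) -
      Real.log (ratioLimit w (k / n))| := Finset.abs_sum_le_sum_abs _ _
    _ ≤ ∑ k ∈ Finset.range m, 2 * |ratioR (gramCoeff n) w k - ratioLimit w (k / n)| :=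
      Finset.sum_le_sum fun k hk => abs_log_sub_log_le
        (half_le_ratioR_gramCoeff ((Finset.mem_range.1 hk).trans hm) hw0 hw)
        (half_le_ratioLimit _ _)
    _ ≤ _ := by
      rw [← Finset.mul_sum]
      have h1 := sum_abs_ratioR_sub_add_le hn hm hw0 hw
      rw [Finset.sum_range_succ] at h1
      have h2 := sum_gramError_le hm.le
      have h3 := half_le_ratioLimit w 0
      have h4 := ratioLimit_le_one (w := w) (sq_div_lt_one hm).le
      have h5 := abs_nonneg (ratioR (gramCoeff n) w m - ratioLimit w (m / n))
      linarith

theorem abs_log_prod_gramCoeff_sub_le {n m : ℕ} (hn : 2 ≤ n) (hm : m < n) :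
    |Real.log (∏ k ∈ Finset.range m, gramCoeff n (k + 1)) -
      ∑ k ∈ Finset.range m, Real.log (gramLimit ((k + 1 : ℕ) / n))| ≤ 11 := by
  rw [Real.log_prod (fun k hk => (gramCoeff_pos (by omega) (by
    have := Finset.mem_range.1 hk; omega)).ne'), ← Finset.sum_sub_distrib]
  refine (Finset.abs_sum_le_sum_abs _ _).trans (le_trans ?_ (sum_gramError_le hm.le))
  exact Finset.sum_le_sum fun k hk => abs_log_gramCoeff_sub_le hn (by omega) (by
    have := Finset.mem_range.1 hk; omega)

theorem abs_sum_div_sub_integral_le {h : ℝ → ℝ} {α : ℝ} (hh : MonotoneOn h (Icc 0 α)) {n m : ℕ}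
    (hn : 0 < n) (hm : (m : ℝ) / n ≤ α) :
    |(n : ℝ)⁻¹ * ∑ k ∈ Finset.range m, h (k / n) - ∫ x in (0 : ℝ)..m / n, h x| ≤
      (n : ℝ)⁻¹ * (h α - h 0) := by
  have hn' : (0 : ℝ) < n := by exact_mod_cast hn
  have h0m : 0 ≤ (m : ℝ) / n := by positivity
  have hg : MonotoneOn (fun x => h (x / n)) (Icc 0 (0 + (m : ℝ))) := by
    intro x hx y hy hxy
    have key : ∀ z ∈ Icc (0 : ℝ) (0 + m), z / n ∈ Icc 0 α := fun z hz =>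
      ⟨div_nonneg hz.1 hn'.le, le_trans (by have := hz.2; gcongr; linarith) hm⟩
    exact hh (key x hx) (key y hy) (by gcongr)
  have h1 := hg.sum_le_integral
  have h2 := hg.integral_le_sum
  have h3 : ∑ i ∈ Finset.range m, h ((i + 1 : ℕ) / n) =
      ∑ i ∈ Finset.range m, h (i / n) + (h (m / n) - h 0) := by
    have := Finset.sum_range_sub (fun i : ℕ => h ((i : ℝ) / n)) m
    rw [Finset.sum_sub_distrib] at this
    simp only [Nat.cast_zero, zero_div] at this
    linarith
  have h4 : ∫ x in (0 : ℝ)..0 + m, h (x / n) = n * ∫ x in (0 : ℝ)..m / n, h x := by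
    rw [intervalIntegral.integral_comp_div _ hn'.ne']
    simp
  have h5 : h (m / n) ≤ h α := hh ⟨h0m, hm⟩ ⟨h0m.trans hm, le_rfl⟩ hm
  simp only [zero_add] at h1 h2 h4
  rw [h3, h4] at h2
  rw [h4] at h1
  have e : (n : ℝ)⁻¹ * ∑ k ∈ Finset.range m, h (k / n) - ∫ x in (0 : ℝ)..m / n, h x =
      -((n : ℝ)⁻¹ * (n * (∫ x in (0 : ℝ)..m / n, h x) - ∑ k ∈ Finset.range m, h (k / n))) := by
    field_simp
    ring
  rw [e, abs_neg, abs_mul, abs_of_nonneg (inv_nonneg.2 hn'.le), abs_of_nonneg (by linarith)]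
  exact mul_le_mul_of_nonneg_left (by linarith) (inv_nonneg.2 hn'.le)

theorem tendsto_floor_div {α : ℝ} (hα : 0 ≤ α) :
    Tendsto (fun n : ℕ => (⌊α * (n : ℝ)⌋₊ : ℝ) / n) atTop (nhds α) :=
  (tendsto_nat_floor_mul_div_atTop hα).comp tendsto_natCast_atTop_atTop

theorem floor_div_le {α : ℝ} (hα : 0 ≤ α) {n : ℕ} (hn : 0 < n) : (⌊α * (n : ℝ)⌋₊ : ℝ) / n ≤ α := by
  rw [div_le_iff₀ (by exact_mod_cast hn)]
  exact Nat.floor_le (by positivity)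

theorem tendsto_integral_floor {h : ℝ → ℝ} {α : ℝ} (hα : 0 ≤ α)
    (hh : MonotoneOn h (Icc 0 α)) :
    Tendsto (fun n : ℕ => ∫ x in (0 : ℝ)..(⌊α * (n : ℝ)⌋₊ : ℝ) / n, h x) atTop
      (nhds (∫ x in (0 : ℝ)..α, h x)) := by
  have hi : IntervalIntegrable h volume 0 α := by
    apply MonotoneOn.intervalIntegrable
    rwa [uIcc_of_le hα]
  have hc := intervalIntegral.continuousOn_primitive_interval' hi left_mem_uIcc
  rw [uIcc_of_le hα] at hc
  refine (hc α ⟨hα, le_rfl⟩).tendsto.comp (tendsto_nhdsWithin_iff.2 ⟨tendsto_floor_div hα, ?_⟩)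
  filter_upwards [eventually_gt_atTop 0] with n hn
  exact ⟨by positivity, floor_div_le hα hn⟩

theorem tendsto_inv_natCast_mul_const (c : ℝ) :
    Tendsto (fun n : ℕ => (n : ℝ)⁻¹ * c) atTop (nhds 0) := by
  simpa using (tendsto_inv_atTop_nhds_zero_nat (𝕜 := ℝ)).mul_const c

theorem tendsto_sum_div_of_monotoneOn {h : ℝ → ℝ} {α : ℝ} (hα : 0 ≤ α)
    (hh : MonotoneOn h (Icc 0 α)) :
    Tendsto (fun n : ℕ => (n : ℝ)⁻¹ * ∑ k ∈ Finset.range ⌊α * (n : ℝ)⌋₊, h (k / n)) atTop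
      (nhds (∫ x in (0 : ℝ)..α, h x)) := by
  have h1 : Tendsto (fun n : ℕ => (n : ℝ)⁻¹ * ∑ k ∈ Finset.range ⌊α * (n : ℝ)⌋₊, h (k / n) -
      ∫ x in (0 : ℝ)..(⌊α * (n : ℝ)⌋₊ : ℝ) / n, h x) atTop (nhds 0) := by
    refine squeeze_zero_norm' ?_ (tendsto_inv_natCast_mul_const (h α - h 0))
    filter_upwards [eventually_gt_atTop 0] with n hn
    exact abs_sum_div_sub_integral_le hh hn (floor_div_le hα hn)
  simpa using h1.add (tendsto_integral_floor hα hh)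

theorem tendsto_sum_succ_div_of_monotoneOn {h : ℝ → ℝ} {α : ℝ} (hα : 0 ≤ α)
    (hh : MonotoneOn h (Icc 0 α)) :
    Tendsto (fun n : ℕ => (n : ℝ)⁻¹ * ∑ k ∈ Finset.range ⌊α * (n : ℝ)⌋₊, h ((k + 1 : ℕ) / n)) atTop
      (nhds (∫ x in (0 : ℝ)..α, h x)) := by
  have h1 : Tendsto (fun n : ℕ => (n : ℝ)⁻¹ * (h ((⌊α * (n : ℝ)⌋₊ : ℝ) / n) - h 0)) atTop
      (nhds 0) := by
    refine squeeze_zero' ?_ ?_ (tendsto_inv_natCast_mul_const (h α - h 0))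
    · filter_upwards [eventually_gt_atTop 0] with n hn
      have h0 : 0 ≤ (⌊α * (n : ℝ)⌋₊ : ℝ) / n := by positivity
      have := hh ⟨le_rfl, hα⟩ ⟨h0, floor_div_le hα hn⟩ h0
      have h2 : 0 ≤ h ((⌊α * (n : ℝ)⌋₊ : ℝ) / n) - h 0 := by linarith
      positivity
    · filter_upwards [eventually_gt_atTop 0] with n hn
      have h0 : 0 ≤ (⌊α * (n : ℝ)⌋₊ : ℝ) / n := by positivity
      have := hh ⟨h0, floor_div_le hα hn⟩ ⟨hα, le_rfl⟩ (floor_div_le hα hn)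
      gcongr
  have h2 := (tendsto_sum_div_of_monotoneOn hα hh).add h1
  rw [add_zero] at h2
  refine h2.congr fun n => ?_
  rw [← mul_add]
  congr 1
  have := Finset.sum_range_sub (fun i : ℕ => h ((i : ℝ) / n)) ⌊α * (n : ℝ)⌋₊
  rw [Finset.sum_sub_distrib] at this
  simp only [Nat.cast_zero, zero_div] at this
  linarith

theorem floor_mul_lt {α : ℝ} (hα : α ∈ Ioo (0 : ℝ) 1) {n : ℕ} (hn : 0 < n) :
    ⌊α * (n : ℝ)⌋₊ < n := by
  have hn' : (0 : ℝ) < n := by exact_mod_cast hn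
  rw [Nat.floor_lt (mul_nonneg hα.1.le hn'.le)]
  nlinarith [hα.2]

theorem monotoneOn_log_ratioLimit (w α : ℝ) :
    MonotoneOn (fun s => Real.log (ratioLimit w s)) (Icc 0 α) := fun s hs t ht hst =>
  Real.log_le_log (by linarith [half_le_ratioLimit w s]) (monotoneOn_ratioLimit w hs.1 ht.1 hst)

theorem antitoneOn_log_gramLimit {α : ℝ} (hα : α < 1) :
    AntitoneOn (fun s => Real.log (gramLimit s)) (Icc 0 α) := by
  intro s hs t ht hst
  apply Real.log_le_log
  · unfold gramLimit
    nlinarith [ht.1, ht.2]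
  · unfold gramLimit
    nlinarith [hs.1]

theorem tendsto_of_abs_sub_le {u v : ℕ → ℝ} {l C : ℝ}
    (hv : Tendsto (fun n : ℕ => (n : ℝ)⁻¹ * v n) atTop (nhds l))
    (h : ∀ n, 2 ≤ n → |u n - v n| ≤ C + 2 * Real.log (2 * √n)) :
    Tendsto (fun n : ℕ => (n : ℝ)⁻¹ * u n) atTop (nhds l) := by
  have hlog : Tendsto (fun n : ℕ => (n : ℝ)⁻¹ * Real.log n) atTop (nhds 0) := by
    have := Real.isLittleO_log_id_atTop.tendsto_div_nhds_zero.comp tendsto_natCast_atTop_atTop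
    refine this.congr fun n => ?_
    simp [div_eq_inv_mul]
  have hb : Tendsto (fun n : ℕ => (n : ℝ)⁻¹ * (C + 2 * Real.log (2 * √n))) atTop (nhds 0) := by
    have := (tendsto_inv_natCast_mul_const (C + 2 * Real.log 2)).add hlog
    rw [add_zero] at this
    refine this.congr' ?_
    filter_upwards [eventually_gt_atTop 0] with n hn
    have hn' : (0 : ℝ) < n := by exact_mod_cast hn
    rw [Real.log_mul (by norm_num) (by positivity), Real.log_sqrt hn'.le]
    ring
  have h1 : Tendsto (fun n : ℕ => (n : ℝ)⁻¹ * (u n - v n)) atTop (nhds 0) := by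
    refine squeeze_zero_norm' ?_ hb
    filter_upwards [eventually_ge_atTop 2] with n hn
    rw [Real.norm_eq_abs, abs_mul, abs_of_nonneg (by positivity)]
    gcongr
    exact h n hn
  have h2 := h1.add hv
  rw [zero_add] at h2
  refine h2.congr fun n => ?_
  ring

theorem tendsto_sum_log_roots {α : ℝ} (hα : α ∈ Ioo (0 : ℝ) 1) {P : ℕ → ℝ[X]}
    (hmonic : ∀ n : ℕ, 2 ≤ n → (P n).Monic)
    (hdeg : ∀ n : ℕ, 2 ≤ n → (P n).natDegree = ⌊α * (n : ℝ)⌋₊)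
    (hmin : ∀ n : ℕ, 2 ≤ n → ∀ Q : ℝ[X], Q.Monic → Q.natDegree = ⌊α * (n : ℝ)⌋₊ →
      normE n (P n) ≤ normE n Q) {w : ℝ} (hw0 : 0 < w) (hw : w ≤ 1 / 8) :
    Tendsto (fun n : ℕ => (n : ℝ)⁻¹ * ((P n).roots.map fun x => Real.log (1 - x * w)).sum) atTop
      (nhds (∫ s in (0 : ℝ)..α, Real.log (ratioLimit w s))) := by
  refine tendsto_of_abs_sub_le (C := 52)
    (tendsto_sum_div_of_monotoneOn hα.1.le (monotoneOn_log_ratioLimit w α)) fun n hn => ?_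
  have hlt := floor_mul_lt hα (show 0 < n by omega)
  have h1 := abs_sum_log_roots_sub_le hn (hmonic n hn) (by rw [hdeg n hn]; exact hlt)
    (fun Q hQ hQd => hmin n hn Q hQ (by rw [hQd, hdeg n hn])) hw0 hw
  rw [hdeg n hn] at h1
  have h2 := abs_sum_log_ratioR_sub_le hn hlt hw0 hw
  exact (abs_sub_le _ _ _).trans ((add_le_add h1 h2).trans_eq (add_comm _ _))

theorem tendsto_log_normE {α : ℝ} (hα : α ∈ Ioo (0 : ℝ) 1) {P : ℕ → ℝ[X]}
    (hmonic : ∀ n : ℕ, 2 ≤ n → (P n).Monic)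
    (hdeg : ∀ n : ℕ, 2 ≤ n → (P n).natDegree = ⌊α * (n : ℝ)⌋₊)
    (hmin : ∀ n : ℕ, 2 ≤ n → ∀ Q : ℝ[X], Q.Monic → Q.natDegree = ⌊α * (n : ℝ)⌋₊ →
      normE n (P n) ≤ normE n Q) :
    Tendsto (fun n : ℕ => (n : ℝ)⁻¹ * Real.log (normE n (P n))) atTop
      (nhds (1 / 2 * ∫ s in (0 : ℝ)..α, Real.log (gramLimit s))) := by
  have hS : Tendsto (fun n : ℕ => (n : ℝ)⁻¹ *
      ∑ k ∈ Finset.range ⌊α * (n : ℝ)⌋₊, Real.log (gramLimit ((k + 1 : ℕ) / n))) atTop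
      (nhds (∫ s in (0 : ℝ)..α, Real.log (gramLimit s))) := by
    have := (tendsto_sum_succ_div_of_monotoneOn hα.1.le
      (antitoneOn_log_gramLimit hα.2).neg).neg
    simpa using this
  have h2 : Tendsto (fun n : ℕ => (n : ℝ)⁻¹ * (2 * Real.log (normE n (P n)))) atTop
      (nhds (∫ s in (0 : ℝ)..α, Real.log (gramLimit s))) := by
    refine tendsto_of_abs_sub_le (C := 11) hS fun n hn => ?_
    have hlt := floor_mul_lt hα (show 0 < n by omega)
    have hd : (P n).natDegree < n := by rw [hdeg n hn]; exact hlt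
    have hpos := normE_pos hn (hmonic n hn).ne_zero hd
    have hprod := prod_gramCoeff_pos hlt
    have hn' : (0 : ℝ) < n := by exact_mod_cast (show 0 < n by omega)
    have hlow := prod_gramCoeff_le_normE_sq hn (hmonic n hn) hd
    rw [hdeg n hn] at hlow
    have hle := hmin n hn _ (recPoly_monic (gramCoeff n) ⌊α * (n : ℝ)⌋₊) (natDegree_recPoly _ _)
    have hup := (pow_le_pow_left₀ hpos.le hle 2).trans (normE_gram_sq_le hn _)
    have l1 := Real.log_le_log hprod hlow
    have l2 := Real.log_le_log (by positivity) hup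
    rw [Real.log_pow] at l1 l2
    rw [Real.log_mul hn'.ne' hprod.ne'] at l2
    have h11 := abs_le.1 (abs_log_prod_gramCoeff_sub_le hn hlt)
    have hlogn : 2 * Real.log (2 * √n) = 2 * Real.log 2 + Real.log n := by
      rw [Real.log_mul (by norm_num) (by positivity), Real.log_sqrt hn'.le]
      ring
    have hlog2 : 0 < Real.log 2 := Real.log_pos (by norm_num)
    have hlogn0 : 0 ≤ Real.log n := Real.log_natCast_nonneg n
    push_cast at l1 l2
    push_cast at h11 ⊢
    rw [hlogn, abs_le]
    constructor <;> linarith [h11.1, h11.2]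
  have h3 := h2.const_mul (1 / 2)
  refine h3.congr fun n => ?_
  ring

/-- The function `1 / √(1 - s² - x²)` on the open unit disc, extended by zero. -/
noncomputable def discKernel (s x : ℝ) : ENNReal :=
  if s ^ 2 + x ^ 2 < 1 then ENNReal.ofReal (1 / √(1 - s ^ 2 - x ^ 2)) else 0

theorem measurable_discKernel : Measurable (Function.uncurry discKernel) := by
  unfold discKernel Function.uncurry
  apply Measurable.ite
  · exact measurableSet_lt (by fun_prop) (by fun_prop)
  · fun_prop
  · fun_prop

theorem lintegral_mul_discKernel (k : ℝ → ENNReal) {s : ℝ} (hs0 : 0 ≤ s) (hs : s < 1) :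
    ∫⁻ x, k x * discKernel s x = ∫⁻ θ in Ioo 0 Real.pi, k (√(1 - s ^ 2) * Real.cos θ) := by
  set c := √(1 - s ^ 2) with hc
  have hc2 : c ^ 2 = 1 - s ^ 2 := Real.sq_sqrt (by nlinarith)
  have hc0 : 0 < c := Real.sqrt_pos.2 (by nlinarith)
  have himg : (fun θ => c * Real.cos θ) '' Ioo 0 Real.pi = Ioo (-c) c := by
    have h : ContinuousOn (fun θ => c * Real.cos θ) (Icc 0 Real.pi) := by fun_prop
    have := h.image_Ioo_of_strictAntiOn Real.pi_pos.le fun x hx y hy hxy =>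
      mul_lt_mul_of_pos_left (Real.strictAntiOn_cos hx hy hxy) hc0
    simpa using this
  have hsupp : ∫⁻ x, k x * discKernel s x = ∫⁻ x in Ioo (-c) c, k x * discKernel s x := by
    rw [← lintegral_indicator measurableSet_Ioo]
    congr 1
    ext x
    by_cases hx : x ∈ Ioo (-c) c
    · rw [indicator_of_mem hx]
    · rw [indicator_of_notMem hx, discKernel, if_neg, mul_zero]
      intro h
      exact hx (abs_lt.1 (abs_lt_of_sq_lt_sq (by linarith) hc0.le))
  rw [hsupp, ← himg, lintegral_image_eq_lintegral_abs_deriv_mul measurableSet_Ioo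
    (fun θ _ => ((Real.hasDerivAt_cos θ).const_mul c).hasDerivWithinAt)]
  · refine setLIntegral_congr_fun measurableSet_Ioo fun θ hθ => ?_
    have hsin := Real.sin_pos_of_mem_Ioo hθ
    have h1 : 1 - s ^ 2 - (c * Real.cos θ) ^ 2 = (c * Real.sin θ) ^ 2 := by
      rw [← hc2]
      linear_combination c ^ 2 * Real.sin_sq_add_cos_sq θ * (-1)
    have h2 : s ^ 2 + (c * Real.cos θ) ^ 2 < 1 := by
      have : 0 < (c * Real.sin θ) ^ 2 := by positivity
      linarith
    rw [discKernel, if_pos h2, h1, Real.sqrt_sq (by positivity), mul_left_comm,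
      ← ENNReal.ofReal_mul (abs_nonneg _), mul_neg, abs_neg, abs_of_pos (by positivity),
      mul_one_div_cancel (by positivity), ENNReal.ofReal_one, mul_one]
  · intro x hx y hy hxy
    exact Real.injOn_cos ⟨hx.1.le, hx.2.le⟩ ⟨hy.1.le, hy.2.le⟩ (mul_left_cancel₀ hc0.ne' hxy)

theorem lintegral_discKernel {α x : ℝ} (hα : 0 < α) (hx : x ∈ Ioo (-1 : ℝ) 1) :
    ∫⁻ s in Ioo 0 α, discKernel s x = ENNReal.ofReal (Real.arcsin (α / √(1 - x ^ 2))) := by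
  set b := √(1 - x ^ 2) with hb
  have hx2 : x ^ 2 < 1 := by nlinarith [hx.1, hx.2]
  have hb2 : b ^ 2 = 1 - x ^ 2 := Real.sq_sqrt (by linarith)
  have hb0 : 0 < b := Real.sqrt_pos.2 (by linarith)
  set τ := Real.arcsin (α / b) with hτ
  have hτ0 : 0 < τ := Real.arcsin_pos.2 (by positivity)
  have hτ1 : τ ≤ Real.pi / 2 := Real.arcsin_le_pi_div_two _
  have hsinτ : b * Real.sin τ = min α b := by
    rcases le_total α b with h | h
    · rw [min_eq_left h, hτ, Real.sin_arcsin (by linarith [div_pos hα hb0]) ((div_le_one hb0).2 h)]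
      field_simp
    · rw [min_eq_right h, hτ, Real.arcsin_of_one_le ((one_le_div hb0).2 h), Real.sin_pi_div_two,
        mul_one]
  have hcont : ContinuousOn (fun t => b * Real.sin t) (Icc 0 τ) := by fun_prop
  have hmono : StrictMonoOn (fun t => b * Real.sin t) (Icc 0 τ) := fun t ht u hu htu =>
    mul_lt_mul_of_pos_left (Real.strictMonoOn_sin ⟨by linarith [ht.1, Real.pi_pos], ht.2.trans hτ1⟩
      ⟨by linarith [hu.1, Real.pi_pos], hu.2.trans hτ1⟩ htu) hb0
  have himg : (fun t => b * Real.sin t) '' Ioo 0 τ = Ioo 0 (min α b) := by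
    simpa [hsinτ] using hcont.image_Ioo_of_strictMonoOn hτ0.le hmono
  have hsupp : ∫⁻ s in Ioo 0 α, discKernel s x = ∫⁻ s in Ioo 0 (min α b), discKernel s x := by
    rw [← lintegral_indicator measurableSet_Ioo, ← lintegral_indicator measurableSet_Ioo]
    congr 1
    ext s
    by_cases hs : s ∈ Ioo 0 (min α b)
    · rw [indicator_of_mem hs, indicator_of_mem (mem_Ioo.2 ⟨hs.1, hs.2.trans_le (min_le_left _ _)⟩)]
    · rw [indicator_of_notMem hs]
      by_cases hs' : s ∈ Ioo 0 α
      · rw [indicator_of_mem hs', discKernel, if_neg]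
        intro h
        exact hs (mem_Ioo.2 ⟨hs'.1, lt_min hs'.2 (lt_of_pow_lt_pow_left₀ 2 hb0.le (by linarith))⟩)
      · rw [indicator_of_notMem hs']
  rw [hsupp, ← himg, lintegral_image_eq_lintegral_abs_deriv_mul measurableSet_Ioo
    (fun t _ => ((Real.hasDerivAt_sin t).const_mul b).hasDerivWithinAt)
    (hmono.injOn.mono Ioo_subset_Icc_self)]
  rw [setLIntegral_congr_fun (g := fun _ => 1) measurableSet_Ioo]
  · simp
  · intro t ht
    have hcos : 0 < Real.cos t := Real.cos_pos_of_mem_Ioo ⟨by linarith [ht.1, Real.pi_pos],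
      ht.2.trans_le hτ1⟩
    have h1 : 1 - (b * Real.sin t) ^ 2 - x ^ 2 = (b * Real.cos t) ^ 2 := by
      rw [sub_right_comm, ← hb2]
      linear_combination b ^ 2 * Real.sin_sq_add_cos_sq t * (-1)
    have h2 : (b * Real.sin t) ^ 2 + x ^ 2 < 1 := by
      have : 0 < (b * Real.cos t) ^ 2 := by positivity
      linarith
    simp only
    rw [discKernel, if_pos h2, h1, Real.sqrt_sq (by positivity),
      ← ENNReal.ofReal_mul (abs_nonneg _), abs_of_pos (by positivity),
      mul_one_div_cancel (by positivity), ENNReal.ofReal_one]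

theorem mualphaDensity_eq {α x : ℝ} (hα : α ∈ Ioo (0 : ℝ) 1) (hx : x ∈ Ioo (-1 : ℝ) 1) :
    mualphaDensity α x = Real.arcsin (α / √(1 - x ^ 2)) * (1 / Real.pi) := by
  obtain ⟨hα0, hα1⟩ := hα
  have hx2 : x ^ 2 < 1 := by nlinarith [hx.1, hx.2]
  have hb2 : √(1 - x ^ 2) ^ 2 = 1 - x ^ 2 := Real.sq_sqrt (by linarith)
  have hb0 : 0 < √(1 - x ^ 2) := Real.sqrt_pos.2 (by linarith)
  set b := √(1 - x ^ 2) with hb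
  unfold mualphaDensity
  split_ifs with h
  · have hlt : α ^ 2 + x ^ 2 < 1 := by
      have := (Real.lt_sqrt (abs_nonneg x)).1 h
      rw [sq_abs] at this
      linarith
    have hαb : α < b := lt_of_pow_lt_pow_left₀ 2 hb0.le (by linarith)
    have hα2 : 0 < α / b := by positivity
    rw [Real.arcsin_eq_arctan ⟨by linarith, (div_lt_one hb0).2 hαb⟩, mul_comm]
    congr 2
    have : √(1 - (α / b) ^ 2) = √(1 - α ^ 2 - x ^ 2) / b := by
      rw [div_pow, ← Real.sqrt_sq hb0.le, ← Real.sqrt_div' _ (by positivity), Real.sqrt_sq hb0.le,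
        hb2]
      congr 1
      have : 1 - x ^ 2 ≠ 0 := by linarith
      field_simp
      ring
    rw [this, div_div_div_cancel_right₀ hb0.ne']
  · rw [Real.arcsin_of_one_le, ← mul_div_assoc, mul_one, div_right_comm,
      div_self Real.pi_ne_zero]
    rw [one_le_div hb0]
    by_contra hlt
    push Not at hlt
    refine h (Real.lt_sqrt_of_sq_lt ?_)
    rw [sq_abs]
    have := pow_lt_pow_left₀ hlt hα0.le two_ne_zero
    linarith

theorem lintegral_mualpha {α : ℝ} (hα : α ∈ Ioo (0 : ℝ) 1) {k : ℝ → ENNReal}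
    (hk : Measurable k) :
    ∫⁻ x, k x ∂mualpha α = ∫⁻ s in Ioo 0 α,
      (∫⁻ θ in Ioo 0 Real.pi, k (√(1 - s ^ 2) * Real.cos θ)) * ENNReal.ofReal (1 / Real.pi) := by
  have hden : Measurable fun x => ENNReal.ofReal (mualphaDensity α x) := by
    unfold mualphaDensity
    refine (Measurable.ite (measurableSet_lt (by fun_prop) (by fun_prop)) ?_
      measurable_const).ennreal_ofReal
    exact (Real.measurable_arctan.comp (by fun_prop)).const_mul _
  have hR : ∫⁻ s in Ioo 0 α, (∫⁻ θ in Ioo 0 Real.pi, k (√(1 - s ^ 2) * Real.cos θ)) *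
      ENNReal.ofReal (1 / Real.pi) =
      ∫⁻ s in Ioo 0 α, ∫⁻ x, k x * discKernel s x * ENNReal.ofReal (1 / Real.pi) := by
    refine setLIntegral_congr_fun measurableSet_Ioo fun s hs => ?_
    rw [lintegral_mul_const' _ _ ENNReal.ofReal_ne_top,
      lintegral_mul_discKernel k hs.1.le (hs.2.trans hα.2)]
  rw [hR, lintegral_lintegral_swap, mualpha, lintegral_withDensity_eq_lintegral_mul _ hden hk,
    Measure.restrict_congr_set Ioo_ae_eq_Icc.symm, ← lintegral_indicator measurableSet_Ioo]
  · congr 1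
    ext x
    by_cases hx : x ∈ Ioo (-1 : ℝ) 1
    · rw [indicator_of_mem hx, lintegral_mul_const' _ _ ENNReal.ofReal_ne_top,
        lintegral_const_mul _ (f := fun s => discKernel s x)
          (measurable_discKernel.comp (measurable_id.prodMk measurable_const)),
        lintegral_discKernel hα.1 hx, Pi.mul_apply, mualphaDensity_eq hα hx,
        ENNReal.ofReal_mul (Real.arcsin_nonneg.2 (div_nonneg hα.1.le (Real.sqrt_nonneg _)))]
      ring
    · rw [indicator_of_notMem hx]
      symm
      rw [setLIntegral_congr_fun (g := fun _ => 0) measurableSet_Ioo, lintegral_zero]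
      intro s hs
      have : 1 ≤ x ^ 2 := by
        rw [one_le_sq_iff_one_le_abs]
        by_contra h
        exact hx (abs_lt.1 (not_le.1 h))
      beta_reduce
      rw [discKernel, if_neg, mul_zero, zero_mul]
      nlinarith [sq_nonneg s]
  · exact (((hk.comp measurable_snd).mul measurable_discKernel).mul_const _).aemeasurable


theorem lintegral_ofReal_mualpha {α : ℝ} (hα : α ∈ Ioo (0 : ℝ) 1) {k K : ℝ → ℝ}
    (hk : Measurable k) (hk0 : ∀ x ∈ Icc (-1 : ℝ) 1, 0 ≤ k x)
    (hK : IntervalIntegrable K volume 0 α)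
    (hint : ∀ s ∈ Ioo 0 α, IntervalIntegrable (fun θ => k (√(1 - s ^ 2) * Real.cos θ)) volume
      0 Real.pi)
    (hval : ∀ s ∈ Ioo 0 α, ∫ θ in (0 : ℝ)..Real.pi, k (√(1 - s ^ 2) * Real.cos θ) =
      Real.pi * K s) :
    ∫⁻ x, ENNReal.ofReal (k x) ∂mualpha α = ENNReal.ofReal (∫ s in (0 : ℝ)..α, K s) ∧
      0 ≤ ∫ s in (0 : ℝ)..α, K s := by
  have hpos : ∀ s θ : ℝ, 0 ≤ k (√(1 - s ^ 2) * Real.cos θ) := fun s θ => by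
    apply hk0
    rw [mem_Icc, ← abs_le, abs_mul, abs_of_nonneg (Real.sqrt_nonneg _)]
    have h1 : √(1 - s ^ 2) ≤ 1 := Real.sqrt_le_one.2 (by nlinarith)
    exact mul_le_one₀ h1 (abs_nonneg _) (Real.abs_cos_le_one θ)
  have hval' : ∀ s ∈ Ioo 0 α, K s = (∫ θ in (0 : ℝ)..Real.pi,
      k (√(1 - s ^ 2) * Real.cos θ)) * (1 / Real.pi) := fun s hs => by
    rw [hval s hs]
    field_simp
  have hK0 : ∀ s ∈ Ioo 0 α, 0 ≤ K s := fun s hs => by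
    rw [hval' s hs]
    exact mul_nonneg (intervalIntegral.integral_nonneg Real.pi_pos.le fun θ _ => hpos s θ)
      (by positivity)
  have hKi : IntegrableOn K (Ioo 0 α) :=
    (intervalIntegrable_iff_integrableOn_Ioo_of_le hα.1.le).1 hK
  have hKe : ∫ s in (0 : ℝ)..α, K s = ∫ s in Ioo 0 α, K s := by
    rw [intervalIntegral.integral_of_le hα.1.le, integral_Ioc_eq_integral_Ioo]
  rw [hKe]
  refine ⟨?_, setIntegral_nonneg measurableSet_Ioo hK0⟩
  rw [lintegral_mualpha hα hk.ennreal_ofReal, ofReal_integral_eq_lintegral_ofReal hKi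
    ((ae_restrict_iff' measurableSet_Ioo).2 (ae_of_all _ hK0))]
  refine setLIntegral_congr_fun measurableSet_Ioo fun s hs => ?_
  rw [hval' s hs, intervalIntegral.integral_of_le Real.pi_pos.le, integral_Ioc_eq_integral_Ioo,
    ENNReal.ofReal_mul (setIntegral_nonneg measurableSet_Ioo fun θ _ => hpos s θ),
    ofReal_integral_eq_lintegral_ofReal
      ((intervalIntegrable_iff_integrableOn_Ioo_of_le Real.pi_pos.le).1 (hint s hs))
      (ae_of_all _ (hpos s))]

theorem ae_mualpha_mem_Icc (α : ℝ) : ∀ᵐ x ∂mualpha α, x ∈ Icc (-1 : ℝ) 1 :=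
  (withDensity_absolutelyContinuous _ _).ae_le (ae_restrict_mem measurableSet_Icc)

theorem integrable_and_integral_mualpha {α : ℝ} (hα : α ∈ Ioo (0 : ℝ) 1) {k K : ℝ → ℝ}
    (hk : Measurable k) (hk0 : ∀ x ∈ Icc (-1 : ℝ) 1, 0 ≤ k x)
    (hK : IntervalIntegrable K volume 0 α)
    (hint : ∀ s ∈ Ioo 0 α, IntervalIntegrable (fun θ => k (√(1 - s ^ 2) * Real.cos θ)) volume
      0 Real.pi)
    (hval : ∀ s ∈ Ioo 0 α, ∫ θ in (0 : ℝ)..Real.pi, k (√(1 - s ^ 2) * Real.cos θ) =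
      Real.pi * K s) :
    Integrable k (mualpha α) ∧ ∫ x, k x ∂mualpha α = ∫ s in (0 : ℝ)..α, K s := by
  obtain ⟨h1, h2⟩ := lintegral_ofReal_mualpha hα hk hk0 hK hint hval
  have hae : 0 ≤ᵐ[mualpha α] k := by
    filter_upwards [ae_mualpha_mem_Icc α] with x hx using hk0 x hx
  refine ⟨⟨hk.aestronglyMeasurable, ?_⟩, ?_⟩
  · rw [hasFiniteIntegral_iff_ofReal hae, h1]
    exact ENNReal.ofReal_lt_top
  · rw [integral_eq_lintegral_of_nonneg_ae hae hk.aestronglyMeasurable, h1,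
      ENNReal.toReal_ofReal h2]

theorem mualpha_univ {α : ℝ} (hα : α ∈ Ioo (0 : ℝ) 1) :
    mualpha α univ = ENNReal.ofReal α := by
  have h := (lintegral_ofReal_mualpha (k := fun _ => 1) (K := fun _ => 1) hα measurable_const
    (fun _ _ => zero_le_one) intervalIntegrable_const (fun _ _ => intervalIntegrable_const)
    (fun _ _ => by simp)).1
  simpa using h

theorem intervalIntegrable_and_integral_log_sub_two_cos {a : ℂ} (ha : a ≠ 0) {t : ℝ}
    (hat : a + a⁻¹ = t) :
    IntervalIntegrable (fun θ => Real.log |t - 2 * Real.cos θ|) volume 0 Real.pi ∧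
      ∫ θ in (0 : ℝ)..Real.pi, Real.log |t - 2 * Real.cos θ| =
        Real.pi * (Real.posLog ‖a‖ + Real.posLog ‖a⁻¹‖) := by
  set p : ℂ[X] := (X - C a) * (X - C a⁻¹) with hp
  have hp0 : p ≠ 0 := mul_ne_zero (X_sub_C_ne_zero _) (X_sub_C_ne_zero _)
  have hnorm : ∀ θ : ℝ, ‖p.eval (circleMap 0 1 θ)‖ = |t - 2 * Real.cos θ| := by
    intro θ
    have he : p.eval (circleMap 0 1 θ) =
        -(Complex.exp (θ * Complex.I) * ((t - 2 * Real.cos θ : ℝ) : ℂ)) := by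
      have h1 : Complex.exp (θ * Complex.I) * Complex.exp (-(θ * Complex.I)) = 1 := by
        rw [← Complex.exp_add]; simp
      have h2 : (2 : ℂ) * Complex.cos θ = Complex.exp (θ * Complex.I) +
          Complex.exp (-(θ * Complex.I)) := by
        rw [Complex.two_cos, neg_mul]
      have h3 : a * a⁻¹ = 1 := mul_inv_cancel₀ ha
      push_cast
      rw [h2, ← hat, hp]
      simp only [eval_mul, eval_sub, eval_X, eval_C, circleMap, zero_add, Complex.ofReal_one,
        one_mul]
      linear_combination h3 - h1
    rw [he, norm_neg, norm_mul, Complex.norm_exp_ofReal_mul_I, one_mul, Complex.norm_real,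
      Real.norm_eq_abs]
  have hint := p.intervalIntegrable_mahlerMeasure
  simp only [hnorm] at hint
  have hM := logMahlerMeasure_mul_eq_add_logMahlerMeasure hp0
  rw [logMahlerMeasure_X_sub_C, logMahlerMeasure_X_sub_C, ← hp, logMahlerMeasure_def,
    Real.circleAverage_def] at hM
  simp only [hnorm, smul_eq_mul] at hM
  have hpi := Real.pi_pos
  have hint1 := hint.mono_set (c := 0) (d := Real.pi) (by
    rw [uIcc_of_le hpi.le, uIcc_of_le (by positivity)]
    exact Icc_subset_Icc le_rfl (by linarith))
  have hint2 := hint.mono_set (c := Real.pi) (d := 2 * Real.pi) (by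
    rw [uIcc_of_le (by linarith), uIcc_of_le (by positivity)]
    exact Icc_subset_Icc hpi.le le_rfl)
  refine ⟨hint1, ?_⟩
  have hsymm : ∫ θ in Real.pi..2 * Real.pi, Real.log |t - 2 * Real.cos θ| =
      ∫ θ in (0 : ℝ)..Real.pi, Real.log |t - 2 * Real.cos θ| := by
    have := intervalIntegral.integral_comp_sub_left (a := 0) (b := Real.pi)
      (fun θ => Real.log |t - 2 * Real.cos θ|) (2 * Real.pi)
    simp only [Real.cos_two_pi_sub, sub_zero] at this
    rw [this]
    congr 1
    ring
  rw [← intervalIntegral.integral_add_adjacent_intervals hint1 hint2, hsymm] at hM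
  rw [← hM]
  field_simp
  ring

theorem integral_log_abs_sub_mul_cos {c x : ℝ} (hc : 0 < c) (hx : |x| ≤ c) :
    IntervalIntegrable (fun θ => Real.log |x - c * Real.cos θ|) volume 0 Real.pi ∧
      ∫ θ in (0 : ℝ)..Real.pi, Real.log |x - c * Real.cos θ| = Real.pi * Real.log (c / 2) := by
  set φ := Real.arccos (x / c) with hφ
  have hx' := abs_le.1 hx
  have hcos : Real.cos φ = x / c := by
    apply Real.cos_arccos
    · rw [le_div_iff₀ hc]; linarith
    · rw [div_le_iff₀ hc]; linarith
  have hat : Complex.exp (φ * Complex.I) + (Complex.exp (φ * Complex.I))⁻¹ =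
      ((2 * (x / c) : ℝ) : ℂ) := by
    rw [← hcos, ← Complex.exp_neg]
    push_cast
    rw [Complex.two_cos, neg_mul]
  obtain ⟨h1, h2⟩ := intervalIntegrable_and_integral_log_sub_two_cos (Complex.exp_ne_zero _) hat
  rw [norm_inv, Complex.norm_exp_ofReal_mul_I, inv_one, Real.posLog_one, add_zero, mul_zero] at h2
  have hae : ∀ᵐ θ ∂volume, θ ∈ uIoc 0 Real.pi →
      Real.log (c / 2) + Real.log |2 * (x / c) - 2 * Real.cos θ| =
        Real.log |x - c * Real.cos θ| := by
    filter_upwards [compl_mem_ae_iff.2 (measure_singleton (μ := volume) φ)] with θ hθ hmem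
    rw [uIoc_of_le Real.pi_pos.le] at hmem
    have hne : 2 * (x / c) - 2 * Real.cos θ ≠ 0 := by
      intro h0
      apply hθ
      exact Real.injOn_cos ⟨hmem.1.le, hmem.2⟩ ⟨Real.arccos_nonneg _, Real.arccos_le_pi _⟩
        (by rw [hcos]; linarith)
    rw [← Real.log_mul (by positivity) (abs_ne_zero.2 hne)]
    have he : x - c * Real.cos θ = c / 2 * (2 * (x / c) - 2 * Real.cos θ) := by
      field_simp
    rw [he, abs_mul, abs_of_pos (half_pos hc)]
  constructor
  · exact (intervalIntegrable_const.add h1).congr_ae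
      ((ae_restrict_iff' measurableSet_uIoc).2 hae)
  · rw [← intervalIntegral.integral_congr_ae hae,
      intervalIntegral.integral_add intervalIntegrable_const h1, h2]
    simp

theorem integral_log_one_sub_mul_cos {u : ℝ} (hu0 : 0 < u) (hu : u < 1) :
    IntervalIntegrable (fun θ => Real.log (1 - u * Real.cos θ)) volume 0 Real.pi ∧
      ∫ θ in (0 : ℝ)..Real.pi, Real.log (1 - u * Real.cos θ) =
        Real.pi * Real.log ((1 + √(1 - u ^ 2)) / 2) := by
  set v := √(1 - u ^ 2) with hv
  have hv2 : v ^ 2 = 1 - u ^ 2 := Real.sq_sqrt (by nlinarith)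
  have hv0 : 0 ≤ v := Real.sqrt_nonneg _
  set q := u / (1 + v) with hq
  have hq0 : 0 < q := by positivity
  have hq1 : q ≤ 1 := by
    rw [hq, div_le_one (by positivity)]
    linarith
  have hat : ((q : ℝ) : ℂ) + ((q : ℝ) : ℂ)⁻¹ = ((2 / u : ℝ) : ℂ) := by
    rw [← Complex.ofReal_inv, ← Complex.ofReal_add]
    congr 1
    rw [hq]
    have : 1 + v ≠ 0 := by positivity
    field_simp
    linear_combination hv2
  obtain ⟨h1, h2⟩ := intervalIntegrable_and_integral_log_sub_two_cos
    (Complex.ofReal_ne_zero.2 hq0.ne') hat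
  have hp1 : Real.posLog q = 0 :=
    Real.posLog_eq_zero_iff q |>.2 (by rwa [abs_of_pos hq0])
  have hp2 : Real.posLog q⁻¹ = Real.log q⁻¹ :=
    Real.posLog_eq_log (by rw [abs_of_pos (by positivity)]; exact (one_le_inv₀ hq0).2 hq1)
  rw [norm_inv, Complex.norm_real, Real.norm_eq_abs, abs_of_pos hq0, hp1, hp2, zero_add] at h2
  have heq : ∀ θ : ℝ, Real.log (u / 2) + Real.log |2 / u - 2 * Real.cos θ| =
      Real.log (1 - u * Real.cos θ) := by
    intro θ
    have hlt : 0 < 1 - u * Real.cos θ := by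
      nlinarith [Real.cos_le_one θ]
    have he : u / 2 * (2 / u - 2 * Real.cos θ) = 1 - u * Real.cos θ := by
      field_simp
    have hlt2 : 0 < 2 / u - 2 * Real.cos θ := by
      by_contra h
      have := mul_nonpos_of_nonneg_of_nonpos (show 0 ≤ u / 2 by positivity) (not_lt.1 h)
      linarith
    rw [abs_of_pos hlt2, ← Real.log_mul (by positivity) hlt2.ne', he]
  simp only [← heq]
  refine ⟨intervalIntegrable_const.add h1, ?_⟩
  rw [intervalIntegral.integral_add intervalIntegrable_const h1, h2,
    intervalIntegral.integral_const, sub_zero, smul_eq_mul, ← mul_add,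
    ← Real.log_mul (by positivity) (by positivity), hq]
  congr 2
  field_simp

theorem integral_log_one_sub_mul_mualpha {α : ℝ} (hα : α ∈ Ioo (0 : ℝ) 1) {w : ℝ} (hw0 : 0 < w)
    (hw : w ≤ 1 / 8) :
    Integrable (fun x => Real.log (1 - x * w)) (mualpha α) ∧
      ∫ x, Real.log (1 - x * w) ∂mualpha α = ∫ s in (0 : ℝ)..α, Real.log (ratioLimit w s) := by
  have : IsFiniteMeasure (mualpha α) := ⟨by rw [mualpha_univ hα]; exact ENNReal.ofReal_lt_top⟩
  have hK : IntervalIntegrable (fun s => Real.log (ratioLimit w s)) volume 0 α := by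
    apply MonotoneOn.intervalIntegrable
    rw [uIcc_of_le hα.1.le]
    exact monotoneOn_log_ratioLimit w α
  have key : ∀ s ∈ Ioo 0 α, IntervalIntegrable
      (fun θ => Real.log (1 - √(1 - s ^ 2) * Real.cos θ * w)) volume 0 Real.pi ∧
      ∫ θ in (0 : ℝ)..Real.pi, Real.log (1 - √(1 - s ^ 2) * Real.cos θ * w) =
        Real.pi * Real.log (ratioLimit w s) := by
    intro s hs
    have hs1 : s ^ 2 < 1 := by nlinarith [hs.1, hs.2, hα.2]
    have hc0 : 0 < √(1 - s ^ 2) := Real.sqrt_pos.2 (by linarith)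
    have hc1 : √(1 - s ^ 2) ≤ 1 := Real.sqrt_le_one.2 (by nlinarith)
    have h := integral_log_one_sub_mul_cos (u := √(1 - s ^ 2) * w) (by positivity) (by nlinarith)
    rw [mul_pow, Real.sq_sqrt (by linarith)] at h
    simpa only [mul_right_comm _ w, ratioLimit] using h
  have hI := integrable_and_integral_mualpha hα (k := fun x => Real.log 2 - Real.log (1 - x * w))
    (K := fun s => Real.log 2 - Real.log (ratioLimit w s)) (by fun_prop)
    (fun x hx => sub_nonneg.2 (Real.log_le_log (by nlinarith [hx.1, hx.2])
      (by nlinarith [hx.1, hx.2])))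
    (intervalIntegrable_const.sub hK)
    (fun s hs => intervalIntegrable_const.sub (key s hs).1)
    (fun s hs => by
      rw [intervalIntegral.integral_sub intervalIntegrable_const (key s hs).1, (key s hs).2]
      simp
      ring)
  have h1 : Integrable (fun x => Real.log (1 - x * w)) (mualpha α) := by
    refine ((integrable_const (Real.log 2)).sub hI.1).congr (ae_of_all _ fun y => ?_)
    simp only [Pi.sub_apply, sub_sub_cancel]
  refine ⟨h1, ?_⟩
  have h2 := hI.2
  rw [integral_sub (integrable_const _) h1,
    intervalIntegral.integral_sub intervalIntegrable_const hK] at h2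
  simp [Measure.real, mualpha_univ hα, ENNReal.toReal_ofReal hα.1.le] at h2
  linarith

theorem logPot_mualpha {α : ℝ} (hα : α ∈ Ioo (0 : ℝ) 1) {x : ℝ}
    (hx : x ∈ Icc (-√(1 - α ^ 2)) √(1 - α ^ 2)) :
    logPot (mualpha α) x = -(1 / 2 * ∫ s in (0 : ℝ)..α, Real.log (gramLimit s)) := by
  have : IsFiniteMeasure (mualpha α) := ⟨by rw [mualpha_univ hα]; exact ENNReal.ofReal_lt_top⟩
  have hK : IntervalIntegrable (fun s => Real.log (gramLimit s)) volume 0 α := by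
    apply AntitoneOn.intervalIntegrable
    rw [uIcc_of_le hα.1.le]
    exact antitoneOn_log_gramLimit hα.2
  have key : ∀ s ∈ Ioo 0 α, IntervalIntegrable
      (fun θ => Real.log |x - √(1 - s ^ 2) * Real.cos θ|) volume 0 Real.pi ∧
      ∫ θ in (0 : ℝ)..Real.pi, Real.log |x - √(1 - s ^ 2) * Real.cos θ| =
        Real.pi * (1 / 2 * Real.log (gramLimit s)) := by
    intro s hs
    have hs1 : s ^ 2 < 1 := by nlinarith [hs.1, hs.2, hα.2]
    have hc0 : 0 < √(1 - s ^ 2) := Real.sqrt_pos.2 (by linarith)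
    have hle : √(1 - α ^ 2) ≤ √(1 - s ^ 2) := Real.sqrt_le_sqrt (by nlinarith [hs.1, hs.2])
    have h := integral_log_abs_sub_mul_cos hc0 ((abs_le.2 hx).trans hle)
    rw [show gramLimit s = (√(1 - s ^ 2) / 2) ^ 2 by
      rw [div_pow, Real.sq_sqrt (by linarith), gramLimit]; norm_num, Real.log_pow]
    refine ⟨h.1, h.2.trans ?_⟩
    push_cast
    ring
  have hr1 : √(1 - α ^ 2) ≤ 1 := Real.sqrt_le_one.2 (by nlinarith)
  have hI := integrable_and_integral_mualpha hα (k := fun y => Real.log 2 - Real.log |x - y|)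
    (K := fun s => Real.log 2 - 1 / 2 * Real.log (gramLimit s)) (by fun_prop)
    (fun y hy => by
      rw [sub_nonneg]
      rcases eq_or_ne (x - y) 0 with h0 | h0
      · rw [h0, abs_zero, Real.log_zero]
        exact Real.log_nonneg (by norm_num)
      · exact Real.log_le_log (abs_pos.2 h0)
          (abs_le.2 ⟨by linarith [hx.1, hy.2], by linarith [hx.2, hy.1]⟩))
    (intervalIntegrable_const.sub (hK.const_mul _))
    (fun s hs => intervalIntegrable_const.sub (key s hs).1)
    (fun s hs => by
      rw [intervalIntegral.integral_sub intervalIntegrable_const (key s hs).1, (key s hs).2,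
        intervalIntegral.integral_const, sub_zero, smul_eq_mul]
      ring)
  have h1 : Integrable (fun y => Real.log |x - y|) (mualpha α) := by
    refine ((integrable_const (Real.log 2)).sub hI.1).congr (ae_of_all _ fun y => ?_)
    simp only [Pi.sub_apply, sub_sub_cancel]
  have h2 := hI.2
  rw [integral_sub (integrable_const _) h1,
    intervalIntegral.integral_sub intervalIntegrable_const (hK.const_mul _),
    intervalIntegral.integral_const_mul] at h2
  simp only [integral_const, Measure.real, mualpha_univ hα, ENNReal.toReal_ofReal hα.1.le,
    intervalIntegral.integral_const, sub_zero] at h2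
  unfold logPot
  simp only [one_div, Real.log_inv]
  rw [integral_neg, ← one_div]
  linarith

theorem sInf_logPot_mualpha {α : ℝ} (hα : α ∈ Ioo (0 : ℝ) 1) :
    sInf (logPot (mualpha α) '' Icc (-√(1 - α ^ 2)) √(1 - α ^ 2)) =
      -(1 / 2 * ∫ s in (0 : ℝ)..α, Real.log (gramLimit s)) := by
  rw [image_congr fun x hx => logPot_mualpha hα hx,
    Nonempty.image_const (nonempty_Icc.2 (by linarith [Real.sqrt_nonneg (1 - α ^ 2)])),
    csInf_singleton]

/-- The averages `n⁻¹ ∑ f` over the multisets `s n` converge to the integral of `f`. -/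
def AveragesTendTo (s : ℕ → Multiset ℝ) (μ : Measure ℝ) (f : ℝ → ℝ) : Prop :=
  Integrable f μ ∧ Tendsto (fun n : ℕ => (n : ℝ)⁻¹ * ((s n).map f).sum) atTop (nhds (∫ x, f x ∂μ))

namespace AveragesTendTo

variable {s : ℕ → Multiset ℝ} {μ : Measure ℝ} {f g : ℝ → ℝ}

theorem add (hf : AveragesTendTo s μ f) (hg : AveragesTendTo s μ g) :
    AveragesTendTo s μ (fun x => f x + g x) := by
  refine ⟨hf.1.add hg.1, ?_⟩
  rw [integral_add hf.1 hg.1]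
  refine (hf.2.add hg.2).congr fun n => ?_
  rw [Multiset.sum_map_add, mul_add]

theorem const_mul (hf : AveragesTendTo s μ f) (c : ℝ) :
    AveragesTendTo s μ (fun x => c * f x) := by
  refine ⟨hf.1.const_mul c, ?_⟩
  rw [integral_const_mul]
  refine (hf.2.const_mul c).congr fun n => ?_
  rw [Multiset.sum_map_mul_left]
  ring

theorem sum {ι : Type*} {t : Finset ι} {F : ι → ℝ → ℝ} (h : ∀ i ∈ t, AveragesTendTo s μ (F i)) :
    AveragesTendTo s μ (fun x => ∑ i ∈ t, F i x) := by
  classical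
  induction t using Finset.induction_on with
  | empty => simp [AveragesTendTo]
  | insert i t hi ih =>
    simp only [Finset.sum_insert hi]
    exact (h i (Finset.mem_insert_self i t)).add
      (ih fun j hj => h j (Finset.mem_insert_of_mem hj))

theorem of_approx [IsFiniteMeasure μ] (hs : ∀ n, 2 ≤ n → ∀ x ∈ s n, x ∈ Icc (-1 : ℝ) 1)
    (hcard : ∀ n, 2 ≤ n → (s n).card ≤ n) (hμ : ∀ᵐ x ∂μ, x ∈ Icc (-1 : ℝ) 1)
    (hf : Integrable f μ)
    (h : ∀ ε > 0, ∃ g, AveragesTendTo s μ g ∧ ∀ x ∈ Icc (-1 : ℝ) 1, |f x - g x| ≤ ε) :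
    AveragesTendTo s μ f := by
  refine ⟨hf, Metric.tendsto_atTop.2 fun ε hε => ?_⟩
  set M := μ.real univ
  have hM : 0 ≤ M := measureReal_nonneg
  set δ := ε / (2 * (2 + M)) with hδ
  have hδ0 : 0 < δ := by positivity
  have hδε : δ * (2 + M) < ε := by
    rw [hδ, div_mul_eq_mul_div, div_lt_iff₀ (by positivity)]
    nlinarith
  obtain ⟨g, hg, hfg⟩ := h δ hδ0
  obtain ⟨N, hN⟩ := Metric.tendsto_atTop.1 hg.2 δ hδ0
  refine ⟨max N 2, fun n hn => ?_⟩
  have hn2 : 2 ≤ n := (le_max_right _ _).trans hn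
  have hn0 : (0 : ℝ) < n := by exact_mod_cast (show 0 < n by omega)
  have h1 := hN n ((le_max_left _ _).trans hn)
  rw [Real.dist_eq] at h1 ⊢
  have h2 : |(n : ℝ)⁻¹ * ((s n).map f).sum - (n : ℝ)⁻¹ * ((s n).map g).sum| ≤ δ := by
    rw [← mul_sub, ← Multiset.sum_map_sub, abs_mul, abs_of_pos (by positivity)]
    have h3 : |((s n).map fun x => f x - g x).sum| ≤ (s n).card * δ := by
      refine Multiset.abs_sum_le_sum_abs.trans ?_
      rw [Multiset.map_map]
      refine (Multiset.sum_le_card_nsmul _ δ fun y hy => ?_).trans_eq (by simp)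
      obtain ⟨x, hx, rfl⟩ := Multiset.mem_map.1 hy
      exact hfg x (hs n hn2 x hx)
    have h4 : ((s n).card : ℝ) ≤ n := by exact_mod_cast hcard n hn2
    rw [inv_mul_le_iff₀ hn0]
    nlinarith
  have h5 : |∫ x, g x ∂μ - ∫ x, f x ∂μ| ≤ δ * M := by
    rw [← integral_sub hg.1 hf, ← Real.norm_eq_abs]
    refine norm_integral_le_of_norm_le_const ?_
    filter_upwards [hμ] with x hx
    rw [Real.norm_eq_abs, abs_sub_comm]
    exact hfg x hx
  have h6 := abs_sub_le ((n : ℝ)⁻¹ * ((s n).map f).sum) ((n : ℝ)⁻¹ * ((s n).map g).sum)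
    (∫ x, f x ∂μ)
  have h7 := abs_sub_le ((n : ℝ)⁻¹ * ((s n).map g).sum) (∫ x, g x ∂μ) (∫ x, f x ∂μ)
  linarith

theorem integrable_of_continuous [IsFiniteMeasure μ] (hμ : ∀ᵐ x ∂μ, x ∈ Icc (-1 : ℝ) 1)
    (hf : Continuous f) : Integrable f μ := by
  obtain ⟨C, hC⟩ := isCompact_Icc.exists_bound_of_continuousOn (s := Icc (-1 : ℝ) 1) hf.continuousOn
  exact Integrable.of_bound hf.aestronglyMeasurable C (hμ.mono fun x hx => hC x hx)

theorem abs_pow_sub_log_remainder_le {w : ℝ} (hw0 : 0 < w) (hw : w ≤ 1 / 8) (m : ℕ) {x : ℝ}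
    (hx : x ∈ Icc (-1 : ℝ) 1) :
    |x ^ (m + 1) - -((m + 1) / w ^ (m + 1)) *
      (Real.log (1 - x * w) + ∑ i ∈ Finset.range m, w ^ (i + 1) / (i + 1) * x ^ (i + 1))| ≤
      2 * (m + 1) * w := by
  have hx1 : |x| ≤ 1 := abs_le.2 hx
  have hxw : |x * w| ≤ w := by
    rw [abs_mul, abs_of_pos hw0]
    exact mul_le_of_le_one_left hw0.le hx1
  have h := Real.abs_log_sub_add_sum_range_le (show |x * w| < 1 by linarith) (m + 1)
  rw [Finset.sum_range_succ] at h
  have e : x ^ (m + 1) - -(((m : ℝ) + 1) / w ^ (m + 1)) *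
      (Real.log (1 - x * w) + ∑ i ∈ Finset.range m, w ^ (i + 1) / (i + 1) * x ^ (i + 1)) =
      ((m : ℝ) + 1) / w ^ (m + 1) * (∑ i ∈ Finset.range m, (x * w) ^ (i + 1) / ((i : ℝ) + 1) +
        (x * w) ^ (m + 1) / ((m : ℝ) + 1) + Real.log (1 - x * w)) := by
    have e1 : ∑ i ∈ Finset.range m, w ^ (i + 1) / ((i : ℝ) + 1) * x ^ (i + 1) =
        ∑ i ∈ Finset.range m, (x * w) ^ (i + 1) / ((i : ℝ) + 1) :=
      Finset.sum_congr rfl fun i _ => by rw [mul_pow]; ring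
    have hm : (m : ℝ) + 1 ≠ 0 := by positivity
    rw [e1, mul_pow x w (m + 1)]
    field_simp
    ring
  have hb : |x * w| ^ (m + 1 + 1) / (1 - |x * w|) ≤ w ^ (m + 1) * (2 * w) := by
    rw [div_le_iff₀ (by linarith)]
    have := pow_le_pow_left₀ (abs_nonneg _) hxw (m + 1 + 1)
    have h0 : 0 ≤ w ^ (m + 1 + 1) := by positivity
    rw [pow_succ w (m + 1)] at this h0
    nlinarith
  rw [e, abs_mul, abs_of_nonneg (by positivity)]
  calc _ ≤ ((m : ℝ) + 1) / w ^ (m + 1) * (w ^ (m + 1) * (2 * w)) := by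
        gcongr
        exact h.trans hb
    _ = _ := by field_simp

theorem pow_of_log [IsFiniteMeasure μ] (hs : ∀ n, 2 ≤ n → ∀ x ∈ s n, x ∈ Icc (-1 : ℝ) 1)
    (hcard : ∀ n, 2 ≤ n → (s n).card ≤ n) (hμ : ∀ᵐ x ∂μ, x ∈ Icc (-1 : ℝ) 1)
    (h0 : AveragesTendTo s μ fun _ => 1)
    (hlog : ∀ w, 0 < w → w ≤ 1 / 8 → AveragesTendTo s μ fun x => Real.log (1 - x * w)) (k : ℕ) :
    AveragesTendTo s μ (fun x => x ^ k) := by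
  induction k using Nat.strong_induction_on with
  | _ k ih =>
    rcases k with _ | m
    · simpa using h0
    refine of_approx hs hcard hμ (integrable_of_continuous hμ (by fun_prop)) fun ε hε => ?_
    set w := min (1 / 8) (ε / (2 * (m + 1))) with hw
    have hw0 : 0 < w := by positivity
    refine ⟨_, ((hlog w hw0 (min_le_left _ _)).add
      (sum (t := Finset.range m) (F := fun i x => w ^ (i + 1) / (i + 1) * x ^ (i + 1)) fun i hi =>
        (ih (i + 1) (by have := Finset.mem_range.1 hi; omega)).const_mul _)).const_mul
          (-((m + 1) / w ^ (m + 1))), fun x hx => ?_⟩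
    refine (abs_pow_sub_log_remainder_le hw0 (min_le_left _ _) m hx).trans ?_
    have h1 : w ≤ ε / (2 * (m + 1)) := min_le_right _ _
    rw [le_div_iff₀ (by positivity)] at h1
    linarith

theorem of_continuous [IsFiniteMeasure μ] (hs : ∀ n, 2 ≤ n → ∀ x ∈ s n, x ∈ Icc (-1 : ℝ) 1)
    (hcard : ∀ n, 2 ≤ n → (s n).card ≤ n) (hμ : ∀ᵐ x ∂μ, x ∈ Icc (-1 : ℝ) 1)
    (hpow : ∀ k : ℕ, AveragesTendTo s μ fun x => x ^ k) (hf : Continuous f) :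
    AveragesTendTo s μ f := by
  refine of_approx hs hcard hμ (integrable_of_continuous hμ hf) fun ε hε => ?_
  obtain ⟨p, hp⟩ := exists_polynomial_near_of_continuousOn (-1) 1 f hf.continuousOn ε hε
  refine ⟨fun x => p.eval x, ?_, fun x hx => ?_⟩
  · simp only [eval_eq_sum_range]
    exact sum fun i _ => (hpow i).const_mul _
  · rw [abs_sub_comm]
    exact (hp x hx).le

end AveragesTendTo

theorem integral_sum_dirac (t : Multiset ℝ) (f : ℝ → ℝ) :
    Integrable f (t.map Measure.dirac).sum ∧ ∫ x, f x ∂(t.map Measure.dirac).sum =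
      (t.map f).sum := by
  induction t using Multiset.induction_on with
  | empty => simp
  | cons a t ih =>
    have ha : Integrable f (Measure.dirac a) := integrable_dirac (by simp)
    rw [Multiset.map_cons, Multiset.sum_cons, Multiset.map_cons, Multiset.sum_cons,
      integral_add_measure ha ih.1, ih.2, integral_dirac]
    exact ⟨ha.add_measure ih.1, rfl⟩

theorem integral_zeroMeasure (n : ℕ) (p : ℝ[X]) (f : ℝ → ℝ) :
    ∫ x, f x ∂zeroMeasure n p = (n : ℝ)⁻¹ * (p.roots.map f).sum := by
  rw [zeroMeasure, integral_smul_measure, (integral_sum_dirac p.roots f).2]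
  simp

theorem chebyshev_grid_zero_distribution (α : ℝ) (hα : α ∈ Set.Ioo (0 : ℝ) 1)
    (r : ℝ) (hr : r = Real.sqrt (1 - α ^ 2))
    (P : ℕ → Polynomial ℝ)
    (hmonic : ∀ n : ℕ, 2 ≤ n → (P n).Monic)
    (hdeg : ∀ n : ℕ, 2 ≤ n → (P n).natDegree = ⌊α * (n : ℝ)⌋₊)
    (hmin : ∀ n : ℕ, 2 ≤ n → ∀ Q : Polynomial ℝ, Q.Monic → Q.natDegree = ⌊α * (n : ℝ)⌋₊ →
      normE n (P n) ≤ normE n Q) :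
    (∀ f : BoundedContinuousFunction ℝ ℝ,
      Tendsto (fun n : ℕ => ∫ x, f x ∂(zeroMeasure n (P n)))
        atTop (nhds (∫ x, f x ∂(mualpha α)))) ∧
    Tendsto (fun n : ℕ => (n : ℝ)⁻¹ * Real.log (normE n (P n)))
      atTop (nhds (- sInf (logPot (mualpha α) '' Set.Icc (-r) r))) := by
  subst hr
  refine ⟨fun f => ?_, ?_⟩
  · have : IsFiniteMeasure (mualpha α) := ⟨by rw [mualpha_univ hα]; exact ENNReal.ofReal_lt_top⟩
    have hlt : ∀ n, 2 ≤ n → (P n).natDegree < n := fun n hn => by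
      rw [hdeg n hn]
      exact floor_mul_lt hα (by omega)
    have hmin' : ∀ n, 2 ≤ n → ∀ Q : ℝ[X], Q.Monic → Q.natDegree = (P n).natDegree →
        normE n (P n) ≤ normE n Q := fun n hn Q hQ hd => hmin n hn Q hQ (by rw [hd, hdeg n hn])
    have hs : ∀ n, 2 ≤ n → ∀ x ∈ (P n).roots, x ∈ Icc (-1 : ℝ) 1 := fun n hn =>
      minimal_roots_mem_Icc hn (hmonic n hn) (hlt n hn) (hmin' n hn)
    have hcard : ∀ n, 2 ≤ n → (P n).roots.card = ⌊α * (n : ℝ)⌋₊ := fun n hn => by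
      rw [(minimal_eq_prod_roots hn (hmonic n hn) (hlt n hn) (hmin' n hn)).2, hdeg n hn]
    have hcard' : ∀ n, 2 ≤ n → (P n).roots.card ≤ n := fun n hn => by
      rw [hcard n hn]
      exact (floor_mul_lt hα (by omega)).le
    have h0 : AveragesTendTo (fun n => (P n).roots) (mualpha α) fun _ => 1 := by
      refine ⟨integrable_const _, ?_⟩
      have hI : ∫ _, (1 : ℝ) ∂mualpha α = α := by
        simp [Measure.real, mualpha_univ hα, ENNReal.toReal_ofReal hα.1.le]
      rw [hI]
      refine (tendsto_floor_div hα.1.le).congr' ?_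
      filter_upwards [eventually_ge_atTop 2] with n hn
      simp [hcard n hn, div_eq_inv_mul]
    have hpow := AveragesTendTo.pow_of_log hs hcard' (ae_mualpha_mem_Icc α) h0 fun w hw0 hw => by
      obtain ⟨h1, h2⟩ := integral_log_one_sub_mul_mualpha hα hw0 hw
      refine ⟨h1, ?_⟩
      rw [h2]
      exact tendsto_sum_log_roots hα hmonic hdeg hmin hw0 hw
    simp only [integral_zeroMeasure]
    exact (AveragesTendTo.of_continuous hs hcard' (ae_mualpha_mem_Icc α) hpow f.continuous).2
  · rw [sInf_logPot_mualpha hα, neg_neg]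
    exact tendsto_log_normE hα hmonic hdeg hmin
end

section
/- Let α ∈ (0,1) and r = √(1−α²). Then (1/π) · ∫_{−r}^{r} arctan( α/√(r²−x²) ) dx + (1−r) = α; equivalently, the measure μ_α has total mass μ_α([−1,1]) = α. -/
open MeasureTheory Polynomial Filter Set

/-- A continuous primitive of `x ↦ arctan (α / √(r² - x²))` on `[-r, r]`, for `α² + r² = 1`. -/
noncomputable def arctanPrimitive (α r x : ℝ) : ℝ :=
  x * (Real.pi / 2 - Real.arctan (√(r ^ 2 - x ^ 2) / α)) + α * Real.arcsin (x / r)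
    - Real.arcsin (α * x / (r * √(1 - x ^ 2)))

theorem arctanPrimitive_neg (α r x : ℝ) : arctanPrimitive α r (-x) = -arctanPrimitive α r x := by
  simp only [arctanPrimitive, neg_sq, neg_div, mul_neg, Real.arcsin_neg]
  ring

theorem arctanPrimitive_self {α r : ℝ} (hα : 0 < α) (hr : 0 < r) (h : α ^ 2 + r ^ 2 = 1) :
    arctanPrimitive α r r = Real.pi / 2 * (r + α - 1) := by
  have h1 : √(1 - r ^ 2) = α := by
    rw [show 1 - r ^ 2 = α ^ 2 by linarith, Real.sqrt_sq hα.le]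
  have h2 : α * r / (r * α) = 1 := by field_simp
  simp only [arctanPrimitive, h1, h2, div_self hr.ne', Real.arcsin_one, sub_self, Real.sqrt_zero,
    zero_div, Real.arctan_zero]
  ring

theorem continuousOn_arctanPrimitive {α r : ℝ} (hα : 0 < α) (hr : 0 < r)
    (h : α ^ 2 + r ^ 2 = 1) : ContinuousOn (arctanPrimitive α r) (Icc (-r) r) := by
  have hdiv : ContinuousOn (fun x : ℝ => α * x / (r * √(1 - x ^ 2))) (Icc (-r) r) := by
    refine ContinuousOn.div (by fun_prop) (by fun_prop) fun x hx => ?_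
    have : 0 < 1 - x ^ 2 := by nlinarith [hx.1, hx.2, sq_pos_of_pos hα]
    exact (mul_pos hr (Real.sqrt_pos.2 this)).ne'
  have harcsin := Real.continuous_arcsin.comp_continuousOn hdiv
  have hrest : Continuous fun x : ℝ =>
      x * (Real.pi / 2 - Real.arctan (√(r ^ 2 - x ^ 2) / α)) + α * Real.arcsin (x / r) := by
    have := Real.continuous_arcsin.comp (continuous_id.div_const r)
    have := Real.continuous_arctan.comp
      ((by fun_prop : Continuous fun x : ℝ => √(r ^ 2 - x ^ 2)).div_const α)
    simp only [Function.comp_def, id] at *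
    fun_prop
  exact hrest.continuousOn.sub harcsin

theorem hasDerivAt_arctanPrimitive {α r x : ℝ} (hα : 0 < α) (hr : 0 < r)
    (h : α ^ 2 + r ^ 2 = 1) (hx : x ∈ Ioo (-r) r) :
    HasDerivAt (arctanPrimitive α r) (Real.arctan (α / √(r ^ 2 - x ^ 2))) x := by
  have hs0 : 0 < r ^ 2 - x ^ 2 := by nlinarith [hx.1, hx.2]
  have ht0 : 0 < 1 - x ^ 2 := by nlinarith [sq_pos_of_pos hα]
  have hds : HasDerivAt (fun y : ℝ => √(r ^ 2 - y ^ 2)) (-x / √(r ^ 2 - x ^ 2)) x := by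
    refine (((hasDerivAt_pow 2 x).const_sub (r ^ 2)).sqrt hs0.ne').congr_deriv ?_
    have := Real.sqrt_pos.2 hs0
    field_simp
    norm_num
  have hdt : HasDerivAt (fun y : ℝ => √(1 - y ^ 2)) (-x / √(1 - x ^ 2)) x := by
    refine (((hasDerivAt_pow 2 x).const_sub 1).sqrt ht0.ne').congr_deriv ?_
    have := Real.sqrt_pos.2 ht0
    field_simp
    norm_num
  have hs2 := Real.sq_sqrt hs0.le
  have ht2 := Real.sq_sqrt ht0.le
  have hsp := Real.sqrt_pos.2 hs0
  have htp := Real.sqrt_pos.2 ht0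
  have hinv : Real.arctan (α / √(r ^ 2 - x ^ 2))
      = Real.pi / 2 - Real.arctan (√(r ^ 2 - x ^ 2) / α) := by
    rw [← Real.arctan_inv_of_pos (by positivity), inv_div]
  rw [hinv]
  generalize hs : √(r ^ 2 - x ^ 2) = s at *
  generalize ht : √(1 - x ^ 2) = t at *
  have hst : s ^ 2 + α ^ 2 = t ^ 2 := by linarith
  have hsqrt₁ : √(1 - (x / r) ^ 2) = s / r := by
    rw [show 1 - (x / r) ^ 2 = (s / r) ^ 2 by field_simp; linarith,
      Real.sqrt_sq (by positivity)]
  have hsqrt₂ : √(1 - (α * x / (r * t)) ^ 2) = s / (r * t) := by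
    rw [show 1 - (α * x / (r * t)) ^ 2 = (s / (r * t)) ^ 2 by
      field_simp
      rw [hs2, ht2]
      linear_combination (-x ^ 2) * h, Real.sqrt_sq (by positivity)]
  have hne {y z : ℝ} (hy : √(1 - y ^ 2) = z) (hz : 0 < z) : y ≠ -1 ∧ y ≠ 1 := by
    constructor <;> rintro rfl <;> norm_num at hy <;> linarith
  obtain ⟨ha, hb⟩ := hne hsqrt₁ (by positivity)
  obtain ⟨hc, hd⟩ := hne hsqrt₂ (by positivity)
  have hatan := (hds.div_const α).arctan
  have hasin₁ := (Real.hasDerivAt_arcsin ha hb).comp x ((hasDerivAt_id x).div_const r)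
  have hquot := ((hasDerivAt_id x).const_mul α).div (hdt.const_mul r) (by rw [ht]; positivity)
  have hasin₂ := (Real.hasDerivAt_arcsin (x := α * x / (r * √(1 - x ^ 2)))
    (by rw [ht]; exact hc) (by rw [ht]; exact hd)).comp x hquot
  refine ((((hasDerivAt_id x).mul (hatan.const_sub (Real.pi / 2))).add
    (hasin₁.const_mul α)).sub hasin₂).congr_deriv ?_
  simp only [id, hs, ht, hsqrt₁, hsqrt₂]
  have hden : 1 + (s / α) ^ 2 = t ^ 2 / α ^ 2 := by
    field_simp
    linarith
  rw [hden]
  field_simp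
  ring

theorem intervalIntegrable_arctan_comp {g : ℝ → ℝ} (hg : Measurable g) (a b : ℝ) :
    IntervalIntegrable (fun x => Real.arctan (g x)) volume a b := by
  refine (intervalIntegrable_const (c := Real.pi / 2)).mono_fun
    (Real.measurable_arctan.comp hg).aestronglyMeasurable (Eventually.of_forall fun x => ?_)
  beta_reduce
  rw [Real.norm_eq_abs, Real.norm_eq_abs, abs_of_pos (by positivity : 0 < Real.pi / 2)]
  exact abs_le.2 ⟨(Real.neg_pi_div_two_lt_arctan _).le, (Real.arctan_lt_pi_div_two _).le⟩

theorem integral_arctan_div_sqrt {α r : ℝ} (hα : 0 < α) (hr : 0 < r) (h : α ^ 2 + r ^ 2 = 1) :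
    ∫ x in (-r)..r, Real.arctan (α / √(r ^ 2 - x ^ 2)) = Real.pi * (r + α - 1) := by
  rw [intervalIntegral.integral_eq_sub_of_hasDerivAt_of_le (by linarith)
    (continuousOn_arctanPrimitive hα hr h) (fun x hx => hasDerivAt_arctanPrimitive hα hr h hx)
    (intervalIntegrable_arctan_comp (by fun_prop) _ _), arctanPrimitive_neg,
    arctanPrimitive_self hα hr h]
  ring

theorem measurable_mualphaDensity (α : ℝ) : Measurable (mualphaDensity α) := by
  unfold mualphaDensity
  refine Measurable.ite (measurableSet_lt (by fun_prop) (by fun_prop)) ?_ (by fun_prop)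
  exact (Real.measurable_arctan.comp (by fun_prop)).const_mul _

theorem mualphaDensity_nonneg {α : ℝ} (hα : 0 ≤ α) (x : ℝ) : 0 ≤ mualphaDensity α x := by
  unfold mualphaDensity
  split_ifs
  · exact mul_nonneg (by positivity) (Real.arctan_nonneg.2 (by positivity))
  · norm_num

theorem mualphaDensity_le (α x : ℝ) : mualphaDensity α x ≤ 1 / 2 := by
  unfold mualphaDensity
  split_ifs
  · rw [one_div, inv_mul_le_iff₀ Real.pi_pos]
    linarith [Real.arctan_lt_pi_div_two (α / √((1 - α ^ 2) - x ^ 2))]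
  · exact le_rfl

theorem intervalIntegrable_mualphaDensity {α : ℝ} (hα : 0 ≤ α) (a b : ℝ) :
    IntervalIntegrable (mualphaDensity α) volume a b := by
  refine (intervalIntegrable_const (c := (1 / 2 : ℝ))).mono_fun
    (measurable_mualphaDensity α).aestronglyMeasurable (Eventually.of_forall fun x => ?_)
  beta_reduce
  rw [Real.norm_of_nonneg (mualphaDensity_nonneg hα x), Real.norm_of_nonneg (by norm_num)]
  exact mualphaDensity_le α x

theorem integral_mualphaDensity {α r : ℝ} (hα : 0 < α) (hr : 0 < r) (h : α ^ 2 + r ^ 2 = 1) :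
    ∫ x in (-1 : ℝ)..1, mualphaDensity α x =
      ((1 / Real.pi) * ∫ x in (-r)..r, Real.arctan (α / √(r ^ 2 - x ^ 2))) + (1 - r) := by
  have hr2 : 1 - α ^ 2 = r ^ 2 := by linarith
  have hr1 : r ≤ 1 := by nlinarith
  have hint := intervalIntegrable_mualphaDensity hα.le
  have hmid : ∫ x in (-r)..r, mualphaDensity α x =
      (1 / Real.pi) * ∫ x in (-r)..r, Real.arctan (α / √(r ^ 2 - x ^ 2)) := by
    rw [← intervalIntegral.integral_const_mul]
    refine intervalIntegral.integral_congr_Ioo_of_le (by linarith) fun x hx => ?_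
    rw [mualphaDensity, hr2, Real.sqrt_sq hr.le, if_pos (abs_lt.2 hx)]
  have hout {x : ℝ} (hx : r ≤ |x|) : mualphaDensity α x = 1 / 2 := by
    rw [mualphaDensity, hr2, Real.sqrt_sq hr.le, if_neg hx.not_gt]
  have hleft : ∫ x in (-1)..(-r), mualphaDensity α x = (1 - r) / 2 := by
    rw [intervalIntegral.integral_congr (g := fun _ => (1 / 2 : ℝ)) fun x hx => ?_]
    · rw [intervalIntegral.integral_const, smul_eq_mul]
      ring
    · rw [uIcc_of_le (by linarith)] at hx
      exact hout (le_abs.2 (Or.inr (by linarith [hx.2])))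
  have hright : ∫ x in r..1, mualphaDensity α x = (1 - r) / 2 := by
    rw [intervalIntegral.integral_congr (g := fun _ => (1 / 2 : ℝ)) fun x hx => ?_]
    · rw [intervalIntegral.integral_const, smul_eq_mul]
      ring
    · rw [uIcc_of_le hr1] at hx
      exact hout (le_abs.2 (Or.inl hx.1))
  rw [← intervalIntegral.integral_add_adjacent_intervals (hint (-1) r) (hint r 1),
    ← intervalIntegral.integral_add_adjacent_intervals (hint (-1) (-r)) (hint (-r) r),
    hleft, hmid, hright]
  ring

theorem mualpha_Icc {α : ℝ} (hα : 0 ≤ α) :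
    mualpha α (Icc (-1 : ℝ) 1) = ENNReal.ofReal (∫ x in (-1 : ℝ)..1, mualphaDensity α x) := by
  have hint := (intervalIntegrable_iff_integrableOn_Icc_of_le (by norm_num)).1
    (intervalIntegrable_mualphaDensity hα (-1) 1)
  rw [mualpha, withDensity_apply _ measurableSet_Icc, Measure.restrict_restrict measurableSet_Icc,
    inter_self, intervalIntegral.integral_of_le (by norm_num), ← integral_Icc_eq_integral_Ioc,
    ofReal_integral_eq_lintegral_ofReal hint (Eventually.of_forall (mualphaDensity_nonneg hα))]

theorem mualpha_total_mass (α : ℝ) (hα : α ∈ Set.Ioo (0 : ℝ) 1)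
    (r : ℝ) (hr : r = Real.sqrt (1 - α ^ 2)) :
    ((1 / Real.pi) * ∫ x in (-r)..r, Real.arctan (α / Real.sqrt (r ^ 2 - x ^ 2)))
        + (1 - r) = α ∧
      mualpha α (Set.Icc (-1 : ℝ) 1) = ENNReal.ofReal α := by
  obtain ⟨hα0, hα1⟩ := hα
  have hpos : 0 < 1 - α ^ 2 := by nlinarith
  have hr0 : 0 < r := hr ▸ Real.sqrt_pos.2 hpos
  have h : α ^ 2 + r ^ 2 = 1 := by
    rw [hr, Real.sq_sqrt hpos.le]
    ring
  have hmass : ((1 / Real.pi) * ∫ x in (-r)..r, Real.arctan (α / Real.sqrt (r ^ 2 - x ^ 2)))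
      + (1 - r) = α := by
    rw [integral_arctan_div_sqrt hα0 hr0 h]
    field_simp
    ring
  exact ⟨hmass, by rw [mualpha_Icc hα0.le, integral_mualphaDensity hα0 hr0 h, hmass]⟩
end
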